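/- arXiv:1511.07251 — 4 statements merged into one kernel-verified Lean document; each statement's English description precedes it below -/
import Mathlib

section
/- Fix M, C > 1, ε > 0 and κ ∈ (0, nε). There exists C' > 0 such that for every x ∈ Ω_M(ε,C): every point y ∈ Ax with ℓ(y) > δ (where δ = M e^{−(n/2)|Δ_x|^{κ/n}}) lies within distance C' e^{−(1/2)|Δ_x|^ε} of the orbit Aℤ^d; more precisely there exist h ∈ SL_d(ℝ) with ‖h − I‖ ≤ C' e^{−(1/2)|Δ_x|^ε} and s ∈ ℝ^d_0 such that y = h a(s) ℤ^d. -/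
open scoped Pointwise

noncomputable section

abbrev SLR (d : ℕ) := Matrix.SpecialLinearGroup (Fin d) ℝ

instance (d : ℕ) : TopologicalSpace (SLR d) := instTopologicalSpaceSubtype

def Gamma (d : ℕ) : Subgroup (SLR d) :=
  (Matrix.SpecialLinearGroup.map (n := Fin d) (Int.castRingHom ℝ)).range

abbrev XSpace (d : ℕ) := SLR d ⧸ Gamma d

def latticeOf (d : ℕ) (x : XSpace d) : Set (Fin d → ℝ) :=
  {w | ∃ g : SLR d, (QuotientGroup.mk g : XSpace d) = x ∧
      ∃ v : Fin d → ℤ, w = (g : Matrix (Fin d) (Fin d) ℝ).mulVec fun i => (v i : ℝ)}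

def shortest (d : ℕ) (x : XSpace d) : ℝ :=
  sInf {r | ∃ w ∈ latticeOf d x, w ≠ 0 ∧ r = ‖w‖}

def aSL (d : ℕ) (t : Fin d → ℝ) (ht : ∑ i, t i = 0) : SLR d :=
  ⟨Matrix.diagonal fun i => Real.exp (t i), by
    rw [Matrix.det_diagonal, ← Real.exp_sum, ht, Real.exp_zero]⟩

def Aorbit (d : ℕ) (x : XSpace d) : Set (XSpace d) :=
  {y | ∃ (t : Fin d → ℝ) (ht : ∑ i, t i = 0), y = aSL d t ht • x}

def stdLat (d : ℕ) : XSpace d := QuotientGroup.mk 1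

/-- The hyperplane `ℝ^d_0` of zero coordinate sum, as a set. -/
def V0 (d : ℕ) : Set (Fin d → ℝ) := {t | ∑ i, t i = 0}

/-- The hyperplane `ℝ^d_0`, as a submodule. -/
def V0sub (d : ℕ) : Submodule ℝ (Fin d → ℝ) :=
  LinearMap.ker (∑ i : Fin d, LinearMap.proj i)

/-- A simplex set: `d` vectors in `ℝ^d_0` summing to zero and spanning `ℝ^d_0`. -/
structure SimplexSet (d : ℕ) where
  elems : Finset (Fin d → ℝ)
  card_eq : elems.card = d
  sum_eq_zero : elems.sum id = 0
  span_eq : Submodule.span ℝ (elems : Set (Fin d → ℝ)) = V0sub d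

/-- The lattice `Δ_Φ` associated to a simplex set. -/
def latticeOfSS {d : ℕ} (Φ : SimplexSet d) : AddSubgroup (Fin d → ℝ) :=
  AddSubgroup.closure (Φ.elems : Set (Fin d → ℝ))

/-- `⌈t⌉ = max_i t_i`. -/
def ceilMax {d : ℕ} (t : Fin d → ℝ) : ℝ := ⨆ i, t i

/-- `ξ_Φ = max_{t ∈ Φ} ⌈t⌉`. -/
def xi {d : ℕ} (Φ : SimplexSet d) : ℝ :=
  sSup (ceilMax '' (Φ.elems : Set (Fin d → ℝ)))

/-- Square root of the absolute Gram determinant of a `(d-1)`-tuple of vectors. -/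
def gram (d : ℕ) (v : Fin (d - 1) → (Fin d → ℝ)) : ℝ :=
  Real.sqrt |(Matrix.of fun i j : Fin (d - 1) => ∑ k, v i k * v j k).det|

/-- The (euclidean) covolume of the lattice generated by a set `S ⊆ ℝ^d_0` of rank `d-1`:
the common value of the Gram determinant over all `(d-1)`-tuples generating the same
subgroup as `S`. -/
def covolSet (d : ℕ) (S : Set (Fin d → ℝ)) : ℝ :=
  sInf {r | ∃ v : Fin (d - 1) → (Fin d → ℝ),
      AddSubgroup.closure (Set.range v) = AddSubgroup.closure S ∧ r = gram d v}

/-- The covolume `|Δ_Φ|`. -/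
def covolSS {d : ℕ} (Φ : SimplexSet d) : ℝ := covolSet d (Φ.elems : Set (Fin d → ℝ))

/-- The set `φ(stab_{UA}(x))` of logarithmic stabilizer times. -/
def stabSet (d : ℕ) (x : XSpace d) : Set (Fin d → ℝ) :=
  {t | (∑ i, t i = 0) ∧ ∃ ε : Fin d → ℝ, (∀ i, ε i = 1 ∨ ε i = -1) ∧
      (fun v => (Matrix.diagonal fun i => ε i * Real.exp (t i)).mulVec v) '' latticeOf d x
        = latticeOf d x}

/-- The lattice `Δ_x = φ(stab_{UA}(x))`. -/
def DeltaX (d : ℕ) (x : XSpace d) : AddSubgroup (Fin d → ℝ) :=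
  AddSubgroup.closure (stabSet d x)

/-- The covolume `|Δ_x|`. -/
def covolX (d : ℕ) (x : XSpace d) : ℝ := covolSet d (stabSet d x)

/-- `Φ` is an `M`-tight simplex set for `x`. -/
def IsTight (d : ℕ) (M : ℝ) (x : XSpace d) (Φ : SimplexSet d) : Prop :=
  (Φ.elems : Set (Fin d → ℝ)) ⊆ (DeltaX d x : Set (Fin d → ℝ)) ∧
  shortest d x ≤ M * Real.exp (-((d - 1 : ℝ) / 2) * xi Φ)

/-- `Ω_M`: points of `Ω` admitting an `M`-tight simplex set. -/
def OmegaM (d : ℕ) (M : ℝ) : Set (XSpace d) :=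
  {x | IsCompact (Aorbit d x) ∧ ∃ Φ : SimplexSet d, IsTight d M x Φ}

/-- The standard simplex set vectors `b_j` (with `-(d-1)` in coordinate `j`, `1` elsewhere). -/
def bstar (d : ℕ) (j : Fin d) : Fin d → ℝ := fun i => if i = j then -(d - 1 : ℝ) else 1

/-- The points `w_τ^{Φ_*} = τ(d⁻¹ ∑_ℓ (ℓ-1) b_ℓ)`. -/
def wStar (d : ℕ) (τ : Equiv.Perm (Fin d)) : Fin d → ℝ :=
  fun i => (d : ℝ)⁻¹ * ∑ ℓ : Fin d, (ℓ : ℝ) * bstar d ℓ (τ.symm i)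

/-- `h` is a distortion map for `Φ`: a linear map with `h Φ_* = |Δ_Φ|^{-1/(d-1)} Φ`. -/
def IsDistortion {d : ℕ} (Φ : SimplexSet d) (h : (Fin d → ℝ) →ₗ[ℝ] (Fin d → ℝ)) : Prop :=
  h '' Set.range (bstar d) =
    (fun v => (covolSS Φ) ^ (-(1 : ℝ) / (d - 1 : ℝ)) • v) '' (Φ.elems : Set (Fin d → ℝ))

/-- `w_τ^Φ = |Δ_Φ|^{1/(d-1)} h_Φ (w_τ^{Φ_*})`. -/
def wPhi {d : ℕ} (Φ : SimplexSet d) (h : (Fin d → ℝ) →ₗ[ℝ] (Fin d → ℝ))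
    (τ : Equiv.Perm (Fin d)) : Fin d → ℝ :=
  (covolSS Φ) ^ ((1 : ℝ) / (d - 1 : ℝ)) • h (wStar d τ)

/-- `S'` is a set of representatives for the cosets `𝒮 / ⟨θ⟩`, `θ` the cyclic rotation. -/
def IsRepSet (d : ℕ) (S' : Set (Equiv.Perm (Fin d))) : Prop :=
  ∀ τ : Equiv.Perm (Fin d), ∃! σ, σ ∈ S' ∧ τ⁻¹ * σ ∈ Subgroup.zpowers (finRotate d)

/-- The closed ball of radius `r` in `ℝ^d_0`. -/
def ballV0 (d : ℕ) (r : ℝ) : Set (Fin d → ℝ) := {t | (∑ i, t i = 0) ∧ ‖t‖ ≤ r}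

/-- Operator norm of a matrix with respect to the supremum norm. -/
def opNorm (d : ℕ) (g : Matrix (Fin d) (Fin d) ℝ) : ℝ :=
  sSup {r | ∃ v : Fin d → ℝ, ‖v‖ ≤ 1 ∧ r = ‖g.mulVec v‖}

/-- Operator norm of a linear map restricted to the hyperplane `ℝ^d_0`. -/
def normOnV0 (d : ℕ) (h : (Fin d → ℝ) →ₗ[ℝ] (Fin d → ℝ)) : ℝ :=
  sSup {r | ∃ v : Fin d → ℝ, (∑ i, v i = 0) ∧ ‖v‖ ≤ 1 ∧ r = ‖h v‖}

/-- `Ω_M(ε, C)`. -/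
def OmegaMEC (d : ℕ) (M ε C : ℝ) : Set (XSpace d) :=
  {x | IsCompact (Aorbit d x) ∧ ∃ Φ : SimplexSet d, IsTight d M x Φ ∧
    ∃ h, IsDistortion Φ h ∧
      ∀ τ : Equiv.Perm (Fin d), ∃ (hw : ∑ i, wPhi Φ h τ i = 0)
        (g : SLR d) (s : Fin d → ℝ) (hs : ∑ i, s i = 0),
        opNorm d ((g : Matrix (Fin d) (Fin d) ℝ) - 1) ≤ C * Real.exp (-(covolX d x) ^ ε) ∧
        aSL d (wPhi Φ h τ) hw • x = (g * aSL d s hs) • stdLat d}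

/-- Homothety–`GL(ℤ)` equivalence of `(d-1)`-tuples: same lattice shape. -/
def shapeRel (d : ℕ) (v w : Fin (d - 1) → (Fin d → ℝ)) : Prop :=
  ∃ c : ℝ, 0 < c ∧ ∃ g : Matrix (Fin (d - 1)) (Fin (d - 1)) ℤ, IsUnit g.det ∧
    ∀ i, w i = c • ∑ j, ((g i j : ℝ) • v j)

/-- The space of shapes of lattices in `ℝ^d_0` (with the quotient topology). -/
def ShapeSpace (d : ℕ) := Quot (shapeRel d)

instance (d : ℕ) : TopologicalSpace (ShapeSpace d) :=
  instTopologicalSpaceQuot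

/-- The shape of the lattice generated by a tuple. -/
def shapeOf (d : ℕ) (v : Fin (d - 1) → (Fin d → ℝ)) : ShapeSpace d := Quot.mk _ v

/-- An enumeration of the elements of a simplex set. -/
def ssEnum {d : ℕ} (Φ : SimplexSet d) : Fin d → (Fin d → ℝ) :=
  fun i => ((Φ.elems.equivFin.symm (finCongr Φ.card_eq.symm i)) : Fin d → ℝ)

/-- The shape of `Δ_Φ` (generated by the first `d-1` elements of `Φ`). -/
def shapeOfSS {d : ℕ} (Φ : SimplexSet d) : ShapeSpace d :=
  shapeOf d fun i : Fin (d - 1) => ssEnum Φ (Fin.castLE (Nat.sub_le d 1) i)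

/-- `Ω_{M,K}`. -/
def OmegaMK (d : ℕ) (M : ℝ) (K : Set (ShapeSpace d)) : Set (XSpace d) :=
  {x | IsCompact (Aorbit d x) ∧ ∃ Φ : SimplexSet d, IsTight d M x Φ ∧ shapeOfSS Φ ∈ K}

theorem latticeOf_mk (d : ℕ) (g : SLR d) :
    latticeOf d (QuotientGroup.mk g) =
      Set.range fun v : Fin d → ℤ =>
        (g : Matrix (Fin d) (Fin d) ℝ).mulVec fun i => (v i : ℝ) := by
  ext w
  constructor
  · rintro ⟨g', hg', v, rfl⟩
    obtain ⟨γ, hγ⟩ := QuotientGroup.eq.1 hg'.symm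
    refine ⟨(γ : Matrix (Fin d) (Fin d) ℤ).mulVec v, ?_⟩
    have h1 : g' = g * Matrix.SpecialLinearGroup.map (Int.castRingHom ℝ) γ := by
      rw [hγ]; group
    have h2 := RingHom.map_mulVec (Int.castRingHom ℝ) (γ : Matrix (Fin d) (Fin d) ℤ) v
    have h3 : (fun i => (((γ : Matrix (Fin d) (Fin d) ℤ).mulVec v i : ℤ) : ℝ)) =
        ((γ : Matrix (Fin d) (Fin d) ℤ).map (Int.castRingHom ℝ)).mulVec
          fun i => (v i : ℝ) := by
      funext i
      exact h2 i
    rw [h1, Matrix.SpecialLinearGroup.coe_mul, ← Matrix.mulVec_mulVec]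
    dsimp only
    rw [h3]
    rfl
  · rintro ⟨v, rfl⟩
    exact ⟨g, rfl, v, rfl⟩

theorem latticeOf_smul (d : ℕ) (g : SLR d) (x : XSpace d) :
    latticeOf d (g • x) = (g : Matrix (Fin d) (Fin d) ℝ).mulVec '' latticeOf d x := by
  induction x using QuotientGroup.induction_on with
  | H h =>
    have : g • (QuotientGroup.mk h : XSpace d) = QuotientGroup.mk (g * h) := rfl
    rw [this, latticeOf_mk, latticeOf_mk, ← Set.range_comp]
    congr 1
    funext v
    simp [Matrix.mulVec_mulVec]

theorem latticeOf_injective (d : ℕ) : Function.Injective (latticeOf d) := by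
  intro x y hxy
  induction x using QuotientGroup.induction_on with
  | H g =>
  induction y using QuotientGroup.induction_on with
  | H h =>
    rw [latticeOf_mk, latticeOf_mk] at hxy
    refine QuotientGroup.eq.2 ?_
    have key : ∀ j : Fin d, ∃ v : Fin d → ℤ, ∀ i,
        ((g⁻¹ * h : SLR d) : Matrix (Fin d) (Fin d) ℝ) i j = v i := by
      intro j
      have : (h : Matrix (Fin d) (Fin d) ℝ).mulVec (fun i => ((Pi.single j 1 : Fin d → ℤ) i : ℝ))
          ∈ Set.range fun v : Fin d → ℤ =>
            (g : Matrix (Fin d) (Fin d) ℝ).mulVec fun i => (v i : ℝ) := by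
        rw [hxy]; exact ⟨_, rfl⟩
      obtain ⟨v, hv⟩ := this
      refine ⟨v, fun i => ?_⟩
      have h1 : (fun i => ((Pi.single j 1 : Fin d → ℤ) i : ℝ)) = Pi.single j 1 := by
        funext i
        by_cases hij : i = j
        · subst hij; simp
        · simp [hij]
      rw [h1] at hv
      have h2 := congrArg ((g⁻¹ : SLR d) : Matrix (Fin d) (Fin d) ℝ).mulVec hv
      dsimp only at h2
      rw [Matrix.mulVec_mulVec, Matrix.mulVec_mulVec, ← Matrix.SpecialLinearGroup.coe_mul,
        ← Matrix.SpecialLinearGroup.coe_mul, inv_mul_cancel, Matrix.SpecialLinearGroup.coe_one,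
        Matrix.one_mulVec] at h2
      have h3 := congrFun h2 i
      rw [Matrix.mulVec_single_one] at h3
      exact h3.symm
    choose v hv using key
    have hmap : (Matrix.of fun i j => v j i).map (Int.castRingHom ℝ) =
        ((g⁻¹ * h : SLR d) : Matrix (Fin d) (Fin d) ℝ) := by
      ext i j
      simp [hv]
    have hdet : (Matrix.of fun i j => v j i).det = 1 := by
      have h1 := (g⁻¹ * h : SLR d).det_coe
      rw [← hmap, ← RingHom.mapMatrix_apply, ← RingHom.map_det] at h1
      exact RingHom.injective_int (Int.castRingHom ℝ) (h1.trans (map_one _).symm)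
    exact ⟨⟨_, hdet⟩, Subtype.ext hmap⟩

/-- The signed diagonal matrix `diag(ε_i e^{t_i})`. -/
def signedDiag {d : ℕ} (e t : Fin d → ℝ) : Matrix (Fin d) (Fin d) ℝ :=
  Matrix.diagonal fun i => e i * Real.exp (t i)

theorem signedDiag_mul {d : ℕ} (e f s t : Fin d → ℝ) :
    signedDiag e s * signedDiag f t = signedDiag (e * f) (s + t) := by
  simp only [signedDiag, Matrix.diagonal_mul_diagonal, Pi.mul_apply, Pi.add_apply, Real.exp_add]
  congr 1
  funext i
  ring

theorem signedDiag_one_zero {d : ℕ} : signedDiag (1 : Fin d → ℝ) 0 = 1 := by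
  simp [signedDiag]

theorem coe_aSL {d : ℕ} (t : Fin d → ℝ) (ht : ∑ i, t i = 0) :
    (aSL d t ht : Matrix (Fin d) (Fin d) ℝ) = signedDiag 1 t := by
  simp [aSL, signedDiag]

theorem signVector_mul_self {d : ℕ} {e : Fin d → ℝ} (he : ∀ i, e i = 1 ∨ e i = -1) : e * e = 1 := by
  funext i
  rcases he i with h | h <;> simp [h]

theorem signedDiag_mul_neg {d : ℕ} {e : Fin d → ℝ} (he : ∀ i, e i = 1 ∨ e i = -1)
    (t : Fin d → ℝ) : signedDiag e t * signedDiag e (-t) = 1 := by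
  rw [signedDiag_mul, signVector_mul_self he, add_neg_cancel, signedDiag_one_zero]

theorem signedDiag_neg_mul {d : ℕ} {e : Fin d → ℝ} (he : ∀ i, e i = 1 ∨ e i = -1)
    (t : Fin d → ℝ) : signedDiag e (-t) * signedDiag e t = 1 := by
  rw [signedDiag_mul, signVector_mul_self he, neg_add_cancel, signedDiag_one_zero]

theorem norm_signedDiag_mulVec_le {d : ℕ} {e : Fin d → ℝ} (he : ∀ i, e i = 1 ∨ e i = -1)
    {t : Fin d → ℝ} {b : ℝ} (hb : ∀ i, t i ≤ b) (v : Fin d → ℝ) :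
    ‖(signedDiag e t).mulVec v‖ ≤ Real.exp b * ‖v‖ := by
  refine (pi_norm_le_iff_of_nonneg (by positivity)).2 fun i => ?_
  rw [signedDiag, Matrix.mulVec_diagonal, norm_mul, norm_mul]
  have h1 : ‖e i‖ = 1 := by rcases he i with h | h <;> simp [h]
  rw [h1, one_mul, Real.norm_eq_abs, Real.abs_exp]
  exact mul_le_mul (Real.exp_le_exp.2 (hb i)) (norm_le_pi_norm v i) (norm_nonneg _)
    (Real.exp_pos _).le

/-- The set of logarithmic stabilizer times is already a group. -/
theorem mem_stabSet_of_mem_DeltaX {d : ℕ} {x : XSpace d} {s : Fin d → ℝ}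
    (hs : s ∈ DeltaX d x) : s ∈ stabSet d x := by
  refine AddSubgroup.closure_induction (p := fun s _ => s ∈ stabSet d x) (fun _ h => h) ?_ ?_ ?_ hs
  · refine ⟨by simp, 1, fun i => Or.inl rfl, ?_⟩
    change (signedDiag 1 0).mulVec '' latticeOf d x = latticeOf d x
    rw [signedDiag_one_zero]
    simp
  · rintro s t - - ⟨hs, e, he, hse⟩ ⟨ht, f, hf, htf⟩
    change (signedDiag e s).mulVec '' latticeOf d x = latticeOf d x at hse
    change (signedDiag f t).mulVec '' latticeOf d x = latticeOf d x at htf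
    refine ⟨by simp [Finset.sum_add_distrib, hs, ht], e * f, fun i => ?_, ?_⟩
    · rcases he i with h | h <;> rcases hf i with h' | h' <;> simp [h, h']
    · change (signedDiag (e * f) (s + t)).mulVec '' latticeOf d x = latticeOf d x
      conv_rhs => rw [← hse, ← htf, Set.image_image]
      simp only [Matrix.mulVec_mulVec, signedDiag_mul]
  · rintro s - ⟨hs, e, he, hse⟩
    change (signedDiag e s).mulVec '' latticeOf d x = latticeOf d x at hse
    refine ⟨by simp [hs], e, he, ?_⟩
    change (signedDiag e (-s)).mulVec '' latticeOf d x = latticeOf d x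
    conv_lhs => rw [← hse, Set.image_image]
    simp [Matrix.mulVec_mulVec, signedDiag_neg_mul he]

theorem shortest_le_of_image_subset {d : ℕ} (hd : 2 ≤ d) {x y : XSpace d} {e t : Fin d → ℝ}
    (he : ∀ i, e i = 1 ∨ e i = -1) {b : ℝ} (hb : ∀ i, t i ≤ b)
    (hxy : (signedDiag e t).mulVec '' latticeOf d x ⊆ latticeOf d y) :
    shortest d y ≤ Real.exp b * shortest d x := by
  have hbound : ∀ w ∈ latticeOf d x, w ≠ 0 → shortest d y ≤ Real.exp b * ‖w‖ := by
    intro w hw hw0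
    refine le_trans (csInf_le ⟨0, ?_⟩ ⟨_, hxy ⟨w, hw, rfl⟩, fun h0 => hw0 ?_, rfl⟩)
      (norm_signedDiag_mulVec_le he hb w)
    · rintro r ⟨w, -, -, rfl⟩
      exact norm_nonneg w
    · have := congrArg (signedDiag e (-t)).mulVec h0
      rwa [Matrix.mulVec_mulVec, signedDiag_neg_mul he, Matrix.one_mulVec,
        Matrix.mulVec_zero] at this
  rw [← div_le_iff₀' (Real.exp_pos b)]
  refine le_csInf ?_ ?_
  · induction x using QuotientGroup.induction_on with
    | H g =>
      let j : Fin d := ⟨0, by omega⟩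
      refine ⟨_, _, ⟨g, rfl, fun _ => 1, rfl⟩, fun h0 => ?_, rfl⟩
      have := congrArg ((g⁻¹ : SLR d) : Matrix (Fin d) (Fin d) ℝ).mulVec h0
      rw [Matrix.mulVec_mulVec, ← Matrix.SpecialLinearGroup.coe_mul, inv_mul_cancel,
        Matrix.SpecialLinearGroup.coe_one, Matrix.one_mulVec, Matrix.mulVec_zero] at this
      simpa using congrFun this j
  · rintro r ⟨w, hw, hw0, rfl⟩
    rw [div_le_iff₀' (Real.exp_pos b)]
    exact hbound w hw hw0

theorem norm_mulVec_le_opNorm {d : ℕ} (g : Matrix (Fin d) (Fin d) ℝ) {v : Fin d → ℝ}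
    (hv : ‖v‖ ≤ 1) : ‖g.mulVec v‖ ≤ opNorm d g := by
  refine le_csSup ⟨‖LinearMap.toContinuousLinearMap g.mulVecLin‖, ?_⟩ ⟨v, hv, rfl⟩
  rintro r ⟨w, hw, rfl⟩
  exact (LinearMap.toContinuousLinearMap g.mulVecLin).unit_le_opNorm w hw

theorem opNorm_conj_signedDiag_le {d : ℕ} (g : Matrix (Fin d) (Fin d) ℝ) {e u : Fin d → ℝ}
    (he : ∀ i, e i = 1 ∨ e i = -1) :
    opNorm d (signedDiag e u * g * signedDiag e (-u)) ≤ Real.exp (2 * ‖u‖) * opNorm d g := by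
  refine csSup_le ⟨_, 0, by simp, rfl⟩ ?_
  rintro r ⟨v, hv, rfl⟩
  have hu : ∀ i, u i ≤ ‖u‖ := fun i => (le_abs_self _).trans (norm_le_pi_norm u i)
  have hu' : ∀ i, (-u) i ≤ ‖u‖ := fun i => (neg_le_abs _).trans (norm_le_pi_norm u i)
  set w := Real.exp (-‖u‖) • (signedDiag e (-u)).mulVec v with hw
  have hw1 : ‖w‖ ≤ 1 := by
    rw [hw, norm_smul, Real.norm_eq_abs, Real.abs_exp]
    calc Real.exp (-‖u‖) * ‖(signedDiag e (-u)).mulVec v‖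
        ≤ Real.exp (-‖u‖) * (Real.exp ‖u‖ * 1) := by
          gcongr
          exact (norm_signedDiag_mulVec_le he hu' v).trans (by gcongr)
      _ = 1 := by rw [mul_one, ← Real.exp_add]; simp
  have hv' : (signedDiag e (-u)).mulVec v = Real.exp ‖u‖ • w := by
    rw [hw, smul_smul, ← Real.exp_add]; simp
  rw [← Matrix.mulVec_mulVec, ← Matrix.mulVec_mulVec, hv', Matrix.mulVec_smul, Matrix.mulVec_smul,
    norm_smul, Real.norm_eq_abs, Real.abs_exp, two_mul, Real.exp_add, mul_assoc]
  gcongr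
  exact (norm_signedDiag_mulVec_le he hu _).trans
    (by gcongr; exact norm_mulVec_le_opNorm g hw1)

theorem sum_fin_cast (d : ℕ) : ∑ i : Fin d, (i : ℝ) = d * (d - 1) / 2 := by
  rw [Fin.sum_univ_eq_sum_range (fun i => (i : ℝ)) d]
  induction d with
  | zero => simp
  | succ k ih => rw [Finset.sum_range_succ, ih]; push_cast; ring

theorem sum_sub_const_smul {ι E : Type*} [Fintype ι] [AddCommGroup E] [Module ℝ E] {T : ι → E}
    (hT : ∑ j, T j = 0) (f : ι → ℝ) (m : ℝ) : ∑ j, (f j - m) • T j = ∑ j, f j • T j := by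
  simp [sub_smul, Finset.sum_sub_distrib, ← Finset.smul_sum, hT]

/-- Quantitative uniqueness of the deep holes of a simplex lattice: a coset of the lattice all of
whose points have maximal coordinate almost at least `(d - 1) / 2 * ξ` contains a point close to
one of the vertices `d⁻¹ ∑ ℓ T_{τ ℓ}`. -/
theorem exists_perm_near_vertex {d : ℕ} (hd : 2 ≤ d) (T : Fin d → Fin d → ℝ)
    (hT : ∑ j, T j = 0) (hT0 : ∀ j, ∑ i, T j i = 0) {ξ r : ℝ} (hr : 0 ≤ r)
    (hξ : ∀ j i, T j i ≤ ξ) (c : Fin d → ℝ)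
    (H : ∀ m : Fin d → ℤ, ∃ i,
      ((d : ℝ) - 1) / 2 * (ξ - r) ≤ (∑ j, (c j + m j) • T j) i) :
    ∃ (τ : Equiv.Perm (Fin d)) (m : Fin d → ℤ),
      ‖∑ j, (c j + m j) • T j - (d : ℝ)⁻¹ • ∑ ℓ : Fin d, (ℓ : ℝ) • T (τ ℓ)‖
        ≤ ((d : ℝ) - 1) ^ 3 / 2 * r := by
  have hdR : (2 : ℝ) ≤ d := by exact_mod_cast hd
  have hdpos : (0 : ℝ) < d := by linarith
  have hξ0 : 0 ≤ ξ := by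
    have h1 := Finset.sum_le_sum fun i (_ : i ∈ Finset.univ) => hξ ⟨0, by omega⟩ i
    rw [hT0] at h1
    simp only [Finset.sum_const, Finset.card_univ, Fintype.card_fin, nsmul_eq_mul] at h1
    exact nonneg_of_mul_nonneg_right h1 hdpos
  have hnorm : ∀ j, ‖T j‖ ≤ ((d : ℝ) - 1) * ξ := by
    intro j
    refine (pi_norm_le_iff_of_nonneg (by nlinarith)).2 fun i => ?_
    rw [Real.norm_eq_abs, abs_le]
    constructor
    · have h1 := Finset.sum_le_sum fun k (_ : k ∈ Finset.univ.erase i) => hξ j k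
      have h2 := Finset.add_sum_erase Finset.univ (T j) (Finset.mem_univ i)
      rw [hT0] at h2
      rw [Finset.sum_const, Finset.card_erase_of_mem (Finset.mem_univ i), Finset.card_univ,
        Fintype.card_fin, nsmul_eq_mul, Nat.cast_sub (by omega), Nat.cast_one] at h1
      linarith
    · exact (hξ j i).trans (by nlinarith)
  set τ := Tuple.sort fun j => Int.fract (c j) with hτ
  set f : Fin d → ℝ := fun ℓ => Int.fract (c (τ ℓ)) with hf
  have hmono : Monotone f := Tuple.monotone_sort fun j => Int.fract (c j)
  set F := ∑ ℓ, f ℓ with hF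
  have hlow : ∀ k : Fin d, -(((d : ℝ) - 1) / 2 * r) ≤
      ξ * (F - d * f k + k - ((d : ℝ) - 1) / 2) := by
    intro k
    obtain ⟨i, hi⟩ := H fun j => -⌊c j⌋ + if τ.symm j < k then 1 else 0
    have e1 : ∑ j, (c j + ((-⌊c j⌋ + if τ.symm j < k then 1 else 0 : ℤ) : ℝ)) • T j =
        ∑ ℓ, (f ℓ + (if ℓ < k then 1 else 0) - f k) • T (τ ℓ) := by
      have hTτ : ∑ ℓ, T (τ ℓ) = 0 := (Equiv.sum_comp τ T).trans hT
      rw [sum_sub_const_smul hTτ, ← Equiv.sum_comp τ]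
      refine Finset.sum_congr rfl fun ℓ _ => ?_
      congr 1
      simp only [hf, Int.fract, Equiv.symm_apply_apply]
      push_cast
      ring
    have hnn : ∀ ℓ, 0 ≤ f ℓ + (if ℓ < k then 1 else 0) - f k := by
      intro ℓ
      split_ifs with h
      · have h1 := Int.fract_nonneg (c (τ ℓ))
        have h2 := (Int.fract_lt_one (c (τ k))).le
        simp only [hf]
        linarith
      · have := hmono (not_lt.1 h)
        linarith
    have e2 : ∑ ℓ : Fin d, (f ℓ + (if ℓ < k then 1 else 0) - f k) = F - d * f k + k := by
      rw [Finset.sum_sub_distrib, Finset.sum_add_distrib, Finset.sum_const, Finset.card_univ,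
        Fintype.card_fin, nsmul_eq_mul, Finset.sum_boole]
      have : (Finset.univ.filter fun ℓ : Fin d => ℓ < k).card = (k : ℕ) := by
        rw [show (Finset.univ.filter fun ℓ : Fin d => ℓ < k) = Finset.Iio k by ext; simp,
          Fin.card_Iio]
      rw [this]
      ring
    rw [e1, Finset.sum_apply] at hi
    have h3 : ∑ ℓ, ((f ℓ + (if ℓ < k then 1 else 0) - f k) • T (τ ℓ)) i ≤
        ∑ ℓ : Fin d, (f ℓ + (if ℓ < k then 1 else 0) - f k) * ξ :=
      Finset.sum_le_sum fun ℓ _ => mul_le_mul_of_nonneg_left (hξ _ _) (hnn ℓ)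
    rw [← Finset.sum_mul, e2] at h3
    nlinarith
  have hzero : ∑ k : Fin d, ξ * (F - d * f k + k - ((d : ℝ) - 1) / 2) = 0 := by
    rw [← Finset.mul_sum]
    simp only [Finset.sum_sub_distrib, Finset.sum_add_distrib, Finset.sum_const, Finset.card_univ,
      Fintype.card_fin, nsmul_eq_mul, ← Finset.mul_sum, sum_fin_cast, ← hF]
    ring
  have habs : ∀ k : Fin d, |ξ * (F - d * f k + k - ((d : ℝ) - 1) / 2)| ≤
      ((d : ℝ) - 1) ^ 2 / 2 * r := by
    intro k
    rw [abs_le]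
    constructor
    · have := hlow k
      have h4 : 0 ≤ (((d : ℝ) - 1) * (d - 2)) / 2 * r := by
        have : 0 ≤ ((d : ℝ) - 1) * (d - 2) := mul_nonneg (by linarith) (by linarith)
        positivity
      nlinarith
    · have h1 := Finset.sum_le_sum fun ℓ (_ : ℓ ∈ Finset.univ.erase k) => hlow ℓ
      have h2 := Finset.add_sum_erase Finset.univ
        (fun k : Fin d => ξ * (F - d * f k + k - ((d : ℝ) - 1) / 2)) (Finset.mem_univ k)
      rw [hzero] at h2
      rw [Finset.sum_const, Finset.card_erase_of_mem (Finset.mem_univ k), Finset.card_univ,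
        Fintype.card_fin, nsmul_eq_mul, Nat.cast_sub (by omega), Nat.cast_one] at h1
      nlinarith
  refine ⟨τ, fun j => -⌊c j⌋, ?_⟩
  set μ := (F - ((d : ℝ) - 1) / 2) / d with hμ
  have e3 : ∑ j, (c j + ((-⌊c j⌋ : ℤ) : ℝ)) • T j - (d : ℝ)⁻¹ • ∑ ℓ : Fin d, (ℓ : ℝ) • T (τ ℓ) =
      ∑ ℓ : Fin d, (f ℓ - (d : ℝ)⁻¹ * ℓ - μ) • T (τ ℓ) := by
    have hTτ : ∑ ℓ, T (τ ℓ) = 0 := (Equiv.sum_comp τ T).trans hT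
    rw [sum_sub_const_smul hTτ, ← Equiv.sum_comp τ, Finset.smul_sum, ← Finset.sum_sub_distrib]
    refine Finset.sum_congr rfl fun ℓ _ => ?_
    rw [smul_smul, ← sub_smul]
    congr 1
    simp only [hf, Int.fract]
    push_cast
    ring
  rw [e3]
  have hterm : ∀ ℓ : Fin d, ‖(f ℓ - (d : ℝ)⁻¹ * ℓ - μ) • T (τ ℓ)‖ ≤
      ((d : ℝ) - 1) ^ 3 / 2 * r / d := by
    intro ℓ
    have e4 : f ℓ - (d : ℝ)⁻¹ * ℓ - μ = -((F - d * f ℓ + ℓ - ((d : ℝ) - 1) / 2) / d) := by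
      rw [hμ]; field_simp; ring
    rw [norm_smul, e4, norm_neg, norm_div, Real.norm_eq_abs, Real.norm_eq_abs,
      abs_of_pos hdpos, div_mul_eq_mul_div]
    refine div_le_div_of_nonneg_right ?_ hdpos.le
    have h5 := habs ℓ
    rw [abs_mul, abs_of_nonneg hξ0] at h5
    calc |F - d * f ℓ + ℓ - ((d : ℝ) - 1) / 2| * ‖T (τ ℓ)‖
        ≤ |F - d * f ℓ + ℓ - ((d : ℝ) - 1) / 2| * (((d : ℝ) - 1) * ξ) := by
          gcongr; exact hnorm _
      _ = ((d : ℝ) - 1) * (ξ * |F - d * f ℓ + ℓ - ((d : ℝ) - 1) / 2|) := by ring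
      _ ≤ ((d : ℝ) - 1) * (((d : ℝ) - 1) ^ 2 / 2 * r) := by
          exact mul_le_mul_of_nonneg_left h5 (by linarith)
      _ = ((d : ℝ) - 1) ^ 3 / 2 * r := by ring
  refine (norm_sum_le _ _).trans ((Finset.sum_le_sum fun ℓ _ => hterm ℓ).trans ?_)
  rw [Finset.sum_const, Finset.card_univ, Fintype.card_fin, nsmul_eq_mul,
    mul_div_cancel₀ _ hdpos.ne']

theorem exists_int_mul_of_subset_closure {ι κ : Type*} [Fintype ι] {v : ι → κ → ℝ}
    {w : ι → κ → ℝ} (h : Set.range w ⊆ AddSubgroup.closure (Set.range v)) :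
    ∃ P : Matrix ι ι ℤ, Matrix.of w = P.map (Int.castRingHom ℝ) * Matrix.of v := by
  have h1 : ∀ i, ∃ p : ι → ℤ, w i = ∑ j, p j • v j := by
    intro i
    have h2 := h ⟨i, rfl⟩
    rw [SetLike.mem_coe, ← Submodule.span_int_eq_addSubgroupClosure] at h2
    obtain ⟨p, hp⟩ := (Submodule.mem_span_range_iff_exists_fun ℤ).1 h2
    exact ⟨p, hp.symm⟩
  choose p hp using h1
  refine ⟨Matrix.of p, ?_⟩
  ext i k
  simp [Matrix.mul_apply, hp i]

theorem gram_eq (d : ℕ) (v : Fin (d - 1) → Fin d → ℝ) :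
    gram d v = √|(Matrix.of v * (Matrix.of v).transpose).det| := by
  rfl

theorem gram_pos {d : ℕ} {v : Fin (d - 1) → Fin d → ℝ} (hv : LinearIndependent ℝ v) :
    0 < gram d v := by
  rw [gram_eq, Real.sqrt_pos, abs_pos]
  intro h0
  obtain ⟨w, hw, hw0⟩ := Matrix.exists_vecMul_eq_zero_iff.2 h0
  have h1 : Matrix.vecMul w (Matrix.of v) = 0 := by
    rw [← Matrix.vecMul_vecMul] at hw0
    have h2 := congrArg (fun z => z ⬝ᵥ w) hw0
    rw [Matrix.vecMul_transpose, zero_dotProduct, dotProduct_comm, Matrix.dotProduct_mulVec] at h2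
    exact dotProduct_self_eq_zero.1 h2
  apply hw
  funext i
  refine Fintype.linearIndependent_iff.1 hv w ?_ i
  rw [← h1]
  funext k
  simp [Matrix.vecMul, dotProduct]

theorem gram_le_of_closure_eq {d : ℕ} {v w : Fin (d - 1) → Fin d → ℝ} (hw : 0 < gram d w)
    (h : AddSubgroup.closure (Set.range v) = AddSubgroup.closure (Set.range w)) :
    gram d w ≤ gram d v := by
  obtain ⟨P, hP⟩ := exists_int_mul_of_subset_closure (v := v) (w := w)
    (by rw [h]; exact AddSubgroup.subset_closure)
  obtain ⟨Q, hQ⟩ := exists_int_mul_of_subset_closure (v := w) (w := v)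
    (by rw [← h]; exact AddSubgroup.subset_closure)
  have key : ∀ {a b : Fin (d - 1) → Fin d → ℝ} {R : Matrix (Fin (d - 1)) (Fin (d - 1)) ℤ},
      Matrix.of a = R.map (Int.castRingHom ℝ) * Matrix.of b →
        gram d a = |(R.det : ℝ)| * gram d b := by
    intro a b R hR
    have hdet : (R.map (Int.castRingHom ℝ)).det = (R.det : ℝ) := by
      rw [← RingHom.mapMatrix_apply, ← RingHom.map_det]; rfl
    rw [gram_eq, gram_eq, hR, Matrix.transpose_mul, Matrix.mul_assoc,
      ← Matrix.mul_assoc (Matrix.of b), Matrix.det_mul, Matrix.det_mul, Matrix.det_transpose, hdet,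
      abs_mul, abs_mul, mul_left_comm, ← sq, Real.sqrt_mul (abs_nonneg _),
      Real.sqrt_sq (abs_nonneg _), mul_comm]
  have h1 := key hP
  have h2 := key hQ
  have hQ0 : Q.det ≠ 0 := by
    intro h0
    rw [h0] at h2
    simp only [Int.cast_zero, abs_zero, zero_mul] at h2
    rw [h2, mul_zero] at h1
    exact hw.ne' h1
  have hQ1 : (1 : ℝ) ≤ |(Q.det : ℝ)| := by exact_mod_cast Int.one_le_abs hQ0
  rw [h2]
  nlinarith

theorem covolSet_nonneg (d : ℕ) (S : Set (Fin d → ℝ)) : 0 ≤ covolSet d S := by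
  refine Real.sInf_nonneg ?_
  rintro r ⟨v, -, rfl⟩
  exact Real.sqrt_nonneg _

theorem finrank_V0sub {d : ℕ} (hd : 1 ≤ d) : Module.finrank ℝ (V0sub d) = d - 1 := by
  have hne : (∑ i : Fin d, LinearMap.proj i : (Fin d → ℝ) →ₗ[ℝ] ℝ) ≠ 0 := by
    intro h0
    have := congrArg (fun l => l (Pi.single (⟨0, hd⟩ : Fin d) 1)) h0
    simp at this
  have h1 := Module.Dual.finrank_ker_add_one_of_ne_zero hne
  rw [Module.finrank_fin_fun] at h1
  have h2 : Module.finrank ℝ (V0sub d) + 1 = d := h1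
  omega

theorem covolSS_pos {d : ℕ} (hd : 2 ≤ d) (Φ : SimplexSet d) : 0 < covolSS Φ := by
  obtain ⟨k, rfl⟩ : ∃ k, d = k + 1 := ⟨d - 1, by omega⟩
  let E : Fin (k + 1) ≃ Φ.elems :=
    (Φ.elems.equivFin.trans (finCongr Φ.card_eq)).symm
  let T : Fin (k + 1) → Fin (k + 1) → ℝ := fun j => E j
  have hrange : Set.range T = Φ.elems := by
    change Set.range (Subtype.val ∘ E) = _
    rw [Set.range_comp, E.surjective.range_eq, Set.image_univ, Subtype.range_coe]
  have hsum : ∑ j, T j = 0 := by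
    rw [← Φ.sum_eq_zero, ← Finset.sum_coe_sort Φ.elems]
    exact Equiv.sum_comp E fun z => (z : Fin (k + 1) → ℝ)
  let v : Fin (k + 1 - 1) → Fin (k + 1) → ℝ := fun i => T i.succ
  have hT0 : T 0 = -∑ i, v i := by
    rw [Fin.sum_univ_succ] at hsum
    exact eq_neg_of_add_eq_zero_left hsum
  have hcl : AddSubgroup.closure (Set.range v) = AddSubgroup.closure (Set.range T) := by
    refine le_antisymm (AddSubgroup.closure_mono ?_) ((AddSubgroup.closure_le _).2 ?_)
    · rintro _ ⟨i, rfl⟩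
      exact ⟨_, rfl⟩
    · rintro _ ⟨j, rfl⟩
      refine Fin.cases ?_ (fun i => AddSubgroup.subset_closure ⟨i, rfl⟩) j
      rw [hT0]
      exact neg_mem (sum_mem fun i _ => AddSubgroup.subset_closure ⟨i, rfl⟩)
  have hspan : Submodule.span ℝ (Set.range v) = V0sub (k + 1) := by
    rw [← Φ.span_eq, ← hrange]
    refine le_antisymm (Submodule.span_mono ?_) (Submodule.span_le.2 ?_)
    · rintro _ ⟨i, rfl⟩
      exact ⟨_, rfl⟩
    · rintro _ ⟨j, rfl⟩
      refine Fin.cases ?_ (fun i => Submodule.subset_span ⟨i, rfl⟩) j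
      rw [hT0]
      exact neg_mem (sum_mem fun i _ => Submodule.subset_span ⟨i, rfl⟩)
  have hli : LinearIndependent ℝ v := by
    rw [linearIndependent_iff_card_eq_finrank_span, Set.finrank, hspan,
      finrank_V0sub (by omega), Fintype.card_fin]
  rw [hrange] at hcl
  refine (gram_pos hli).trans_le (le_csInf ⟨_, v, hcl, rfl⟩ ?_)
  rintro r ⟨w, hw, rfl⟩
  exact gram_le_of_closure_eq (gram_pos hli) (hw.trans hcl.symm)

theorem apply_le_xi {d : ℕ} (Φ : SimplexSet d) {t : Fin d → ℝ} (ht : t ∈ Φ.elems) (i : Fin d) :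
    t i ≤ xi Φ :=
  (le_ciSup (Set.finite_range t).bddAbove i).trans
    (le_csSup ((Φ.elems.finite_toSet.image _).bddAbove) ⟨t, ht, rfl⟩)

/-- A distortion map enumerates the simplex set, compatibly with the points `w_τ^Φ`. -/
theorem IsDistortion.exists_enum {d : ℕ} (hd : 2 ≤ d) {Φ : SimplexSet d}
    {h : (Fin d → ℝ) →ₗ[ℝ] (Fin d → ℝ)} (hh : IsDistortion Φ h) :
    ∃ T : Fin d → Fin d → ℝ, Set.range T = Φ.elems ∧ ∑ j, T j = 0 ∧
      ∀ τ, wPhi Φ h τ = (d : ℝ)⁻¹ • ∑ ℓ : Fin d, (ℓ : ℝ) • T (τ ℓ) := by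
  have hc := covolSS_pos hd Φ
  set a := covolSS Φ ^ ((1 : ℝ) / (d - 1 : ℝ)) with ha
  let T : Fin d → Fin d → ℝ := fun j => a • h (bstar d j)
  have hrange : Set.range T = Φ.elems := by
    have h1 : Set.range T = (fun v => a • v) '' (h '' Set.range (bstar d)) := by
      rw [← Set.range_comp, ← Set.range_comp]
      rfl
    have h2 : a * covolSS Φ ^ (-(1 : ℝ) / (d - 1 : ℝ)) = 1 := by
      rw [ha, ← Real.rpow_add hc, ← add_div]
      simp
    rw [h1, hh, Set.image_image]
    simp [smul_smul, h2]
  have himg : Finset.univ.image T = Φ.elems := by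
    apply Finset.coe_injective
    rw [Finset.coe_image, Finset.coe_univ, Set.image_univ, hrange]
  have hinj : Function.Injective T := by
    rw [← Set.injOn_univ, ← Finset.coe_univ, ← Finset.card_image_iff, himg, Φ.card_eq,
      Finset.card_univ, Fintype.card_fin]
  refine ⟨T, hrange, ?_, fun τ => ?_⟩
  · rw [← Φ.sum_eq_zero, ← himg, Finset.sum_image fun _ _ _ _ hxy => hinj hxy]
    rfl
  · have h1 : wStar d τ = (d : ℝ)⁻¹ • ∑ ℓ : Fin d, (ℓ : ℝ) • bstar d (τ ℓ) := by
      funext i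
      simp [wStar, bstar, Equiv.symm_apply_eq]
    rw [wPhi, ← ha, h1, map_smul, map_sum, smul_comm, Finset.smul_sum]
    congr 1
    refine Finset.sum_congr rfl fun ℓ _ => ?_
    rw [map_smul, smul_comm]

theorem exists_forall_mul_rpow_le {a p q : ℝ} (ha : 0 ≤ a) (hp : 0 < p) (hpq : p < q) :
    ∃ B : ℝ, ∀ t : ℝ, 0 ≤ t → a * t ^ p ≤ B + 1 / 2 * t ^ q := by
  refine ⟨a * ((2 * a) ^ (q - p)⁻¹) ^ p, fun t ht => ?_⟩
  have hqp : 0 < q - p := sub_pos.2 hpq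
  rcases le_total (2 * a) (t ^ (q - p)) with h | h
  · have h1 : t ^ q = t ^ (q - p) * t ^ p := by
      rw [← Real.rpow_add_of_nonneg ht hqp.le hp.le, sub_add_cancel]
    have h2 : 0 ≤ t ^ p := by positivity
    have h3 : 0 ≤ a * ((2 * a) ^ (q - p)⁻¹) ^ p := by positivity
    rw [h1]
    nlinarith
  · have h1 : t ≤ (2 * a) ^ (q - p)⁻¹ := by
      rwa [Real.le_rpow_inv_iff_of_pos ht (by positivity) hqp]
    have h2 : 0 ≤ t ^ q := by positivity
    have : a * t ^ p ≤ a * ((2 * a) ^ (q - p)⁻¹) ^ p := by gcongr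
    linarith

theorem image_signedDiag_stdLat {d : ℕ} {e : Fin d → ℝ} (he : ∀ i, e i = 1 ∨ e i = -1) :
    (signedDiag e 0).mulVec '' latticeOf d (stdLat d) = latticeOf d (stdLat d) := by
  have hsub : (signedDiag e 0).mulVec '' latticeOf d (stdLat d) ⊆ latticeOf d (stdLat d) := by
    choose z hz using fun i => show ∃ z : ℤ, e i = z from
      (he i).elim (fun h => ⟨1, by simp [h]⟩) fun h => ⟨-1, by simp [h]⟩
    rw [stdLat, latticeOf_mk]
    rintro _ ⟨_, ⟨v, rfl⟩, rfl⟩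
    refine ⟨z * v, ?_⟩
    funext i
    simp [signedDiag, Matrix.mulVec_diagonal, hz]
  refine hsub.antisymm fun w hw => ⟨_, hsub ⟨w, hw, rfl⟩, ?_⟩
  rw [Matrix.mulVec_mulVec]
  have := signedDiag_mul_neg he (0 : Fin d → ℝ)
  rw [neg_zero] at this
  rw [this, Matrix.one_mulVec]

/-- If `a(w) x = g a(s) ℤ^d` and `t` equals `u + w` up to the stabilizer time `s'` of `x`, then
`a(t) x` is the translate of an element of `A ℤ^d` by a conjugate of `g`. -/
theorem exists_conj_of_stabSet {d : ℕ} {x : XSpace d} {t w u s s' : Fin d → ℝ}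
    (ht : ∑ i, t i = 0) (hw : ∑ i, w i = 0) (hs : ∑ i, s i = 0) (hs' : s' ∈ stabSet d x)
    (htu : t + s' = u + w) {g : SLR d} (hg : aSL d w hw • x = (g * aSL d s hs) • stdLat d) :
    ∃ (g' : SLR d) (e : Fin d → ℝ) (r : Fin d → ℝ) (hr : ∑ i, r i = 0),
      (∀ i, e i = 1 ∨ e i = -1) ∧
      (g' : Matrix (Fin d) (Fin d) ℝ) = signedDiag e u * g * signedDiag e (-u) ∧
      aSL d t ht • x = (g' * aSL d r hr) • stdLat d := by
  obtain ⟨hs0, e, he, hstab⟩ := hs'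
  change (signedDiag e s').mulVec '' latticeOf d x = latticeOf d x at hstab
  have hu : ∑ i, u i = 0 := by
    have := congrArg (fun z : Fin d → ℝ => ∑ i, z i) htu
    simpa [Finset.sum_add_distrib, ht, hs0, hw] using this.symm
  have hdet : (signedDiag e u * (g : Matrix (Fin d) (Fin d) ℝ) * signedDiag e (-u)).det = 1 := by
    rw [Matrix.det_mul_right_comm, signedDiag_mul_neg he, Matrix.one_mul, g.det_coe]
  obtain ⟨g', hgg'⟩ : ∃ g' : SLR d, (g' : Matrix (Fin d) (Fin d) ℝ) =
      signedDiag e u * g * signedDiag e (-u) := ⟨⟨_, hdet⟩, rfl⟩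
  refine ⟨g', e, u + s, by simp [Finset.sum_add_distrib, hu, hs], he, hgg', ?_⟩
  apply latticeOf_injective
  have hg' := congrArg (latticeOf d) hg
  rw [latticeOf_smul, latticeOf_smul, Matrix.SpecialLinearGroup.coe_mul, coe_aSL, coe_aSL] at hg'
  rw [latticeOf_smul, latticeOf_smul, Matrix.SpecialLinearGroup.coe_mul, coe_aSL, coe_aSL, hgg']
  calc (signedDiag 1 t).mulVec '' latticeOf d x
      = (signedDiag e u).mulVec '' ((signedDiag 1 w).mulVec '' latticeOf d x) := by
        conv_lhs => rw [← hstab]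
        simp only [Set.image_image, Matrix.mulVec_mulVec, signedDiag_mul, htu, one_mul, mul_one]
    _ = (signedDiag e u * g * signedDiag e (-u) * signedDiag 1 (u + s)).mulVec ''
          ((signedDiag e 0).mulVec '' latticeOf d (stdLat d)) := by
        rw [hg']
        have hd1 : signedDiag e (-u) * (signedDiag 1 (u + s) * signedDiag e 0) =
            signedDiag 1 s := by
          rw [signedDiag_mul, signedDiag_mul, one_mul, signVector_mul_self he, add_zero,
            neg_add_cancel_left]
        simp only [Set.image_image, Matrix.mulVec_mulVec, Matrix.mul_assoc, hd1]
    _ = _ := by rw [image_signedDiag_stdLat he]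

theorem stmt6 (d : ℕ) (hd : 2 ≤ d) (M C ε κ : ℝ) (hM : 1 < M) (hC : 1 < C) (hε : 0 < ε)
    (hκ0 : 0 < κ) (hκ : κ < (d - 1 : ℝ) * ε) :
    ∃ C' : ℝ, 0 < C' ∧ ∀ x ∈ OmegaMEC d M ε C, ∀ y ∈ Aorbit d x,
      M * Real.exp (-((d - 1 : ℝ) / 2) * (covolX d x) ^ (κ / (d - 1 : ℝ))) < shortest d y →
        ∃ (g : SLR d) (s : Fin d → ℝ) (hs : ∑ i, s i = 0),
          opNorm d ((g : Matrix (Fin d) (Fin d) ℝ) - 1) ≤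
            C' * Real.exp (-(1 / 2) * (covolX d x) ^ ε) ∧
          y = (g * aSL d s hs) • stdLat d := by
  have hdR : (2 : ℝ) ≤ d := by exact_mod_cast hd
  have hn : (0 : ℝ) < d - 1 := by linarith
  obtain ⟨B, hB⟩ := exists_forall_mul_rpow_le (a := ((d : ℝ) - 1) ^ 3) (p := κ / (d - 1 : ℝ))
    (q := ε) (by positivity) (by positivity) (by rwa [div_lt_iff₀' hn])
  refine ⟨C * Real.exp B, by positivity, ?_⟩
  rintro x ⟨-, Φ, ⟨hΦx, htight⟩, h, hh, hτ⟩ y ⟨t, ht, rfl⟩ hshort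
  have hcov : 0 ≤ covolX d x := covolSet_nonneg d _
  set r := covolX d x ^ (κ / (d - 1 : ℝ)) with hr
  have hr0 : 0 ≤ r := by positivity
  obtain ⟨T, hTΦ, hTsum, hTw⟩ := hh.exists_enum hd
  have hTmem : ∀ j, T j ∈ Φ.elems := fun j => by
    rw [← Finset.mem_coe, ← hTΦ]; exact ⟨j, rfl⟩
  have hT0 : ∀ j, ∑ i, T j i = 0 := fun j => by
    have h1 : T j ∈ V0sub d := Φ.span_eq ▸ Submodule.subset_span (hTmem j)
    simpa [V0sub] using h1
  have hTstab : ∀ m : Fin d → ℤ, ∑ j, (m j : ℝ) • T j ∈ stabSet d x := by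
    intro m
    refine mem_stabSet_of_mem_DeltaX (sum_mem fun j _ => ?_)
    rw [Int.cast_smul_eq_zsmul]
    exact zsmul_mem (hΦx (hTmem j)) _
  obtain ⟨c, hc⟩ : ∃ c : Fin d → ℝ, ∑ j, c j • T j = t := by
    rw [← Submodule.mem_span_range_iff_exists_fun, hTΦ, Φ.span_eq]
    simpa [V0sub] using ht
  have hsplit : ∀ m : Fin d → ℤ, ∑ j, (c j + m j) • T j = t + ∑ j, (m j : ℝ) • T j := by
    intro m
    simp only [add_smul, Finset.sum_add_distrib, hc]
  obtain ⟨τ, m, hm⟩ := exists_perm_near_vertex hd T hTsum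
    hT0 hr0
    (fun j i => apply_le_xi Φ (hTmem j) i) c (fun m => by
      by_contra! hlt
      obtain ⟨-, e, he, hstab⟩ := hTstab m
      refine absurd hshort (not_lt.2 ?_)
      refine (shortest_le_of_image_subset (x := x) hd he (fun i => (hlt i).le) ?_).trans ?_
      · rw [latticeOf_smul, coe_aSL, hsplit]
        change (signedDiag e _).mulVec '' latticeOf d x = latticeOf d x at hstab
        conv_rhs => rw [← hstab]
        simp only [Set.image_image, Matrix.mulVec_mulVec, signedDiag_mul, one_mul]
        exact subset_rfl
      · refine (mul_le_mul_of_nonneg_left htight (Real.exp_pos _).le).trans_eq ?_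
        rw [mul_left_comm, ← Real.exp_add]
        congr 2
        ring)
  rw [← hTw, hsplit] at hm
  obtain ⟨hw, g, s, hs, hgn, hgx⟩ := hτ τ
  obtain ⟨g', e, s', hs', he, hg', hy⟩ := exists_conj_of_stabSet ht hw hs (hTstab m)
    (sub_add_cancel _ _).symm hgx
  refine ⟨g', s', hs', ?_, hy⟩
  set u := t + ∑ j, (m j : ℝ) • T j - wPhi Φ h τ
  have hconj : (g' : Matrix (Fin d) (Fin d) ℝ) - 1 =
      signedDiag e u * ((g : Matrix (Fin d) (Fin d) ℝ) - 1) * signedDiag e (-u) := by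
    rw [hg', Matrix.mul_sub, Matrix.sub_mul, Matrix.mul_one, signedDiag_mul_neg he]
  rw [hconj]
  calc opNorm d (signedDiag e u * ((g : Matrix (Fin d) (Fin d) ℝ) - 1) * signedDiag e (-u))
      ≤ Real.exp (2 * ‖u‖) * (C * Real.exp (-(covolX d x) ^ ε)) :=
        (opNorm_conj_signedDiag_le _ he).trans (by gcongr)
    _ = C * Real.exp (2 * ‖u‖ - covolX d x ^ ε) := by
        rw [sub_eq_add_neg, Real.exp_add]; ring
    _ ≤ C * Real.exp (B + -(1 / 2) * covolX d x ^ ε) := by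
        gcongr
        have := hB _ hcov
        linarith
    _ = C * Real.exp B * Real.exp (-(1 / 2) * covolX d x ^ ε) := by
        rw [Real.exp_add]; ring
end
end

section
/- Fix d ≥ 2 and η > 0. For all but finitely many m ∈ ℤ^d(η), the polynomial p_m(x) = ∏_{j=1}^d (x − m_j) − 1 is irreducible over ℚ and has d real roots θ_1,…,θ_d which, suitably ordered, satisfy |θ_j − m_j| ≤ C(η) ‖m‖^{−n} for a constant C(η) depending only on η (and d), where n = d−1. -/
open Polynomial

noncomputable section

/-- `ℤ^d(η)`: integer vectors whose coordinates are pairwise separated by `η‖m‖`. -/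
def Zdeta (d : ℕ) (η : ℝ) : Set (Fin d → ℤ) :=
  {m | ∀ i j : Fin d, i ≠ j → η * ‖(fun i => (m i : ℝ))‖ ≤ |(m i : ℝ) - (m j : ℝ)|}

/-- The polynomial `p_m(x) = ∏_{j=1}^d (x - m_j) - 1` over `ℤ`. -/
def pm (d : ℕ) (m : Fin d → ℤ) : Polynomial ℤ :=
  (∏ j : Fin d, (Polynomial.X - Polynomial.C (m j))) - 1

/-- Subtracting one from a nonempty product of monic linear factors keeps it monic. -/
lemma monic_prod_X_sub_C_sub_one {R : Type*} [CommRing R] [Nontrivial R] {d : ℕ} (hd : 0 < d)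
    (a : Fin d → R) : ((∏ j, (X - C (a j))) - 1 : R[X]).Monic := by
  apply (monic_prod_X_sub_C a Finset.univ).sub_of_left
  rw [degree_one, degree_eq_natDegree (monic_prod_X_sub_C a Finset.univ).ne_zero,
    natDegree_finsetProd_X_sub_C_eq_card]
  simpa using hd

lemma natDegree_prod_X_sub_C_sub_one {R : Type*} [CommRing R] [Nontrivial R] {d : ℕ}
    (a : Fin d → R) : ((∏ j, (X - C (a j))) - 1 : R[X]).natDegree = d := by
  rw [← C_1, natDegree_sub_C, natDegree_finsetProd_X_sub_C_eq_card]
  simp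

lemma pm_monic {d : ℕ} (hd : 0 < d) (m : Fin d → ℤ) : (pm d m).Monic :=
  monic_prod_X_sub_C_sub_one hd m

lemma eval_pm_self {d : ℕ} (m : Fin d → ℤ) (j : Fin d) : (pm d m).eval (m j) = -1 := by
  simp [pm, eval_prod, Finset.prod_eq_zero (Finset.mem_univ j)]

/-- Schur's theorem: for distinct integers `m j`, the polynomial `∏ (X - m j) - 1` is irreducible
over `ℤ`. -/
lemma irreducible_pm {d : ℕ} (hd : 0 < d) {m : Fin d → ℤ} (hm : Function.Injective m) :
    Irreducible (pm d m) := by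
  have hdeg : (pm d m).natDegree = d := natDegree_prod_X_sub_C_sub_one m
  rw [(pm_monic hd m).irreducible_iff_natDegree]
  refine ⟨fun h => by rw [h, natDegree_one] at hdeg; omega, fun f g hf hg hfg => ?_⟩
  by_contra! hne
  have hsum : f.natDegree + g.natDegree = d := by rw [← hf.natDegree_mul hg, hfg, hdeg]
  have hzero : f + g = 0 := by
    refine eq_zero_of_natDegree_lt_card_of_eval_eq_zero _ hm (fun j => ?_) ?_
    · have h : f.eval (m j) * g.eval (m j) = -1 := by rw [← eval_mul, hfg, eval_pm_self]
      rw [eval_add]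
      rcases Int.eq_one_or_neg_one_of_mul_eq_neg_one' h with h | h <;> omega
    · rw [Fintype.card_fin]
      have := natDegree_add_le f g
      omega
  have hfg' : f = -g := eq_neg_of_add_eq_zero_left hzero
  have hlead := congrArg leadingCoeff hfg'
  rw [leadingCoeff_neg, hf.leadingCoeff, hg.leadingCoeff] at hlead
  omega

/-- If the points `a i` are `2 * r`-separated and `1 ≤ ε * r ^ (d - 1)` with `ε < r`, then
`∏ (x - a i)` takes the value one within `ε` of each `a j`. -/
lemma exists_prod_sub_eq_one {d : ℕ} (a : Fin d → ℝ) {r ε : ℝ} (hε : 0 < ε) (hεr : ε < r)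
    (hsep : ∀ i j, i ≠ j → 2 * r ≤ |a i - a j|) (hprod : 1 ≤ ε * r ^ (d - 1)) (j : Fin d) :
    ∃ x, |x - a j| ≤ ε ∧ ∏ i, (x - a i) = 1 := by
  set q : ℝ → ℝ := fun x => ∏ i, (x - a i) with hq
  have hsplit (x : ℝ) : q x = (x - a j) * ∏ i ∈ Finset.univ.erase j, (x - a i) :=
    (Finset.mul_prod_erase _ _ (Finset.mem_univ j)).symm
  have hlarge (x : ℝ) (hx : |x - a j| = ε) : 1 ≤ |q x| := by
    rw [hsplit, abs_mul, hx, Finset.abs_prod]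
    refine hprod.trans (mul_le_mul_of_nonneg_left ?_ hε.le)
    have hcard : (Finset.univ.erase j).card = d - 1 := by simp
    rw [← hcard, ← Finset.prod_const]
    refine Finset.prod_le_prod (fun _ _ => by linarith) fun i hi => ?_
    have h1 := hsep j i (Finset.ne_of_mem_erase hi).symm
    have h2 := abs_sub_le (a j) x (a i)
    rw [abs_sub_comm (a j) x] at h2
    linarith
  have hneg : q (a j + ε) * q (a j - ε) < 0 := by
    rw [hsplit, hsplit]
    have hpos : 0 < (∏ i ∈ Finset.univ.erase j, (a j + ε - a i)) *
        ∏ i ∈ Finset.univ.erase j, (a j - ε - a i) := by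
      rw [← Finset.prod_mul_distrib]
      refine Finset.prod_pos fun i hi => ?_
      have h1 := hsep j i (Finset.ne_of_mem_erase hi).symm
      have h2 : ε ^ 2 < (a j - a i) ^ 2 := by
        rw [sq_lt_sq, abs_of_pos hε]
        linarith
      nlinarith
    nlinarith [mul_pos (mul_pos hε hε) hpos]
  have hplus := hlarge (a j + ε) (by simp [abs_of_pos hε])
  have hminus := hlarge (a j - ε) (by simp [abs_of_pos hε])
  have hmem : (1 : ℝ) ∈ Set.uIcc (q (a j - ε)) (q (a j + ε)) := by
    rw [Set.mem_uIcc]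
    rcases mul_neg_iff.mp hneg with ⟨h1, h2⟩ | ⟨h1, h2⟩
    · rw [abs_of_pos h1] at hplus
      exact Or.inl ⟨by linarith, hplus⟩
    · rw [abs_of_pos h2] at hminus
      exact Or.inr ⟨by linarith, hminus⟩
  have hcont : Continuous q := by fun_prop
  obtain ⟨x, hx, hx1⟩ := intermediate_value_uIcc hcont.continuousOn hmem
  rw [Set.uIcc_of_le (by linarith)] at hx
  exact ⟨x, abs_le.mpr ⟨by linarith [hx.1], by linarith [hx.2]⟩, hx1⟩

/-- A monic polynomial with as many distinct known roots as its degree is the product of the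
corresponding linear factors. -/
lemma eq_prod_X_sub_C_of_injective {K : Type*} [Field K] {d : ℕ} {p : K[X]}
    (hp : p.Monic) (hdeg : p.natDegree = d) {θ : Fin d → K} (hθ : Function.Injective θ)
    (hroot : ∀ j, p.eval (θ j) = 0) : p = ∏ j, (X - C (θ j)) := by
  refine eq_of_monic_of_dvd_of_natDegree_le (monic_prod_X_sub_C θ Finset.univ) hp ?_ ?_
  · exact Finset.prod_dvd_of_coprime (fun _ _ _ _ hij => pairwise_coprime_X_sub_C hθ hij)
      fun j _ => dvd_iff_isRoot.mpr (hroot j)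
  · rw [natDegree_finsetProd_X_sub_C_eq_card, hdeg]
    simp

lemma finite_setOf_norm_intCast_le (d : ℕ) (K : ℝ) :
    {m : Fin d → ℤ | ‖(fun i => (m i : ℝ))‖ ≤ K}.Finite := by
  refine (Set.finite_Icc (fun _ => -⌈K⌉ : Fin d → ℤ) (fun _ => ⌈K⌉)).subset fun m hm => ?_
  have h (i : Fin d) : |m i| ≤ ⌈K⌉ := by
    have h1 := (norm_le_pi_norm (fun i => (m i : ℝ)) i).trans (hm.trans (Int.le_ceil K))
    rw [Real.norm_eq_abs] at h1
    exact_mod_cast h1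
  exact ⟨fun i => (abs_le.mp (h i)).1, fun i => (abs_le.mp (h i)).2⟩

theorem stmt8 (d : ℕ) (hd : 2 ≤ d) (η : ℝ) (hη : 0 < η) :
    ∃ C : ℝ, 0 < C ∧
      {m ∈ Zdeta d η | ¬ (Irreducible ((pm d m).map (Int.castRingHom ℚ)) ∧
        ∃ θ : Fin d → ℝ, Function.Injective θ ∧
          (pm d m).map (Int.castRingHom ℝ) =
            ∏ j : Fin d, (Polynomial.X - Polynomial.C (θ j)) ∧
          ∀ j, |θ j - (m j : ℝ)| ≤
            C * ‖(fun i => (m i : ℝ))‖ ^ (-(d - 1 : ℝ)))}.Finite := by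
  refine ⟨(2 / η) ^ (d - 1), by positivity,
    (finite_setOf_norm_intCast_le d (max 1 (2 * (2 / η) ^ (d - 1) / η))).subset ?_⟩
  rintro m ⟨hm, hnot⟩
  by_contra hlarge
  rw [Set.mem_ofPred_eq, not_le, max_lt_iff] at hlarge
  refine hnot ?_
  set M : ℝ := ‖(fun i => (m i : ℝ))‖
  obtain ⟨hM1, hM2⟩ := hlarge
  have hM0 : 0 < M := by linarith
  set r : ℝ := η * M / 2 with hr
  have hexp : M ^ (-(d - 1 : ℝ)) = (M ^ (d - 1))⁻¹ := by
    rw [Real.rpow_neg hM0.le, ← Real.rpow_natCast, Nat.cast_sub (by omega), Nat.cast_one]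
  rw [hexp]
  set ε : ℝ := (2 / η) ^ (d - 1) * (M ^ (d - 1))⁻¹ with hεdef
  have hε : 0 < ε := by positivity
  have hεr : ε < r := by
    have h1 : ε ≤ (2 / η) ^ (d - 1) :=
      mul_le_of_le_one_right (by positivity) (inv_le_one_of_one_le₀ (one_le_pow₀ hM1.le))
    rw [div_lt_iff₀ hη] at hM2
    linarith
  have hprod : ε * r ^ (d - 1) = 1 := by
    rw [hεdef, hr, ← inv_pow, ← mul_pow, ← mul_pow]
    have : 2 / η * M⁻¹ * (η * M / 2) = 1 := by field_simp
    rw [this, one_pow]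
  have hsep (i j : Fin d) (hij : i ≠ j) : 2 * r ≤ |(m i : ℝ) - m j| := by
    linarith [hm i j hij]
  have hinj : Function.Injective m := by
    intro i j hij
    by_contra hne
    have := hsep i j hne
    rw [hij, sub_self, abs_zero] at this
    linarith
  have hd0 : 0 < d := by omega
  refine ⟨((pm_monic hd0 m).irreducible_iff_irreducible_map_fraction_map (K := ℚ)).mp
    (irreducible_pm hd0 hinj), ?_⟩
  choose θ hθ hθ1 using exists_prod_sub_eq_one (fun i => (m i : ℝ)) hε hεr hsep hprod.ge
  have hθinj : Function.Injective θ := by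
    intro i j hij
    by_contra hne
    have h1 := hsep i j hne
    have h2 := abs_sub_le (m i : ℝ) (θ i) (m j)
    have h3 := hθ i
    have h4 := hθ j
    rw [abs_sub_comm] at h3
    rw [← hij] at h4
    linarith
  refine ⟨θ, hθinj, eq_prod_X_sub_C_of_injective ((pm_monic hd0 m).map _) ?_ hθinj fun j => ?_, hθ⟩
  · rw [(pm_monic hd0 m).natDegree_map]
    exact natDegree_prod_X_sub_C_sub_one m
  · simp [pm, Polynomial.map_prod, eval_prod, hθ1 j]
end
end

section
/- For every simplex set Φ ⊂ ℝ^d_0 one has ℝ^d_0 = (n/2) S_Φ + Δ_Φ; i.e., every t ∈ ℝ^d_0 can be written as t = s + u with s in the dilated simplex (n/2)S_Φ and u ∈ Δ_Φ. -/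
open scoped Pointwise

noncomputable section

/-- Some translate `c - c w` of a finite family of reals has fractional parts of small sum. -/
theorem exists_sum_fract_sub_le {ι : Type*} (s : Finset ι) (hs : s.Nonempty) (c : ι → ℝ) :
    ∃ w ∈ s, ∑ v ∈ s, Int.fract (c v - c w) ≤ ((s.card : ℝ) - 1) / 2 := by
  classical
  apply Finset.exists_le_of_sum_le hs
  have hpair : ∀ v w : ι, Int.fract (c v - c w) + Int.fract (c w - c v) ≤
      1 - if v = w then (1 : ℝ) else 0 := by
    intro v w
    split_ifs with h
    · simp [h]
    · have h1 := Int.fract_add_fract_le (c v - c w) (c w - c v)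
      by_cases h0 : Int.fract (c v - c w) = 0
      · linarith [Int.fract_lt_one (c w - c v)]
      · have h2 := Int.fract_neg h0
        rw [neg_sub] at h2
        linarith
  have hsum := Finset.sum_le_sum fun w (_ : w ∈ s) =>
    Finset.sum_le_sum fun v (_ : v ∈ s) => hpair v w
  have hcomm : ∑ w ∈ s, ∑ v ∈ s, Int.fract (c w - c v) =
      ∑ w ∈ s, ∑ v ∈ s, Int.fract (c v - c w) := Finset.sum_comm
  simp only [Finset.sum_add_distrib, Finset.sum_sub_distrib, hcomm, Finset.sum_ite_eq',
    Finset.sum_const, nsmul_eq_mul, mul_one] at hsum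
  rw [Finset.sum_congr rfl fun w hw => if_pos hw] at hsum
  simp only [Finset.sum_const, nsmul_eq_mul, mul_one] at hsum ⊢
  linarith

/-- A nonnegative combination with total weight `a > 0` lies in the `a`-dilated convex hull. -/
theorem sum_smul_mem_smul_convexHull {E : Type*} [AddCommGroup E] [Module ℝ E]
    (s : Finset E) {a : ℝ} (ha : 0 < a) (b : E → ℝ) (hb : ∀ v ∈ s, 0 ≤ b v)
    (hsum : ∑ v ∈ s, b v = a) :
    ∑ v ∈ s, b v • v ∈ a • convexHull ℝ (s : Set E) := by
  rw [Set.mem_smul_set_iff_inv_smul_mem₀ ha.ne', ← hsum]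
  exact s.centerMass_mem_convexHull hb (hsum ▸ ha) fun v hv => hv

theorem stmt10 (d : ℕ) (hd : 2 ≤ d) (Φ : SimplexSet d) :
    V0 d = ((d - 1 : ℝ) / 2) • convexHull ℝ (Φ.elems : Set (Fin d → ℝ)) +
      (latticeOfSS Φ : Set (Fin d → ℝ)) := by
  have hV0 : V0 d = (V0sub d : Set (Fin d → ℝ)) := by
    ext t
    simp [V0, V0sub]
  have hd' : (2 : ℝ) ≤ d := by exact_mod_cast hd
  apply Set.Subset.antisymm
  · intro t ht
    rw [hV0, ← Φ.span_eq, SetLike.mem_coe, Submodule.mem_span_finset] at ht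
    obtain ⟨c, -, rfl⟩ := ht
    have hne : Φ.elems.Nonempty := by
      rw [← Finset.card_pos, Φ.card_eq]
      omega
    obtain ⟨w, -, hw⟩ := exists_sum_fract_sub_le Φ.elems hne c
    rw [Φ.card_eq] at hw
    set S := ∑ v ∈ Φ.elems, Int.fract (c v - c w)
    have hzero : ∀ r : ℝ, ∑ v ∈ Φ.elems, r • v = 0 := fun r => by
      rw [← Finset.smul_sum]
      exact (congrArg (r • ·) Φ.sum_eq_zero).trans (smul_zero r)
    refine ⟨∑ v ∈ Φ.elems, (Int.fract (c v - c w) + ((d - 1 : ℝ) / 2 - S) / d) • v,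
      sum_smul_mem_smul_convexHull _ (by linarith) _ (fun v _ => ?_) ?_,
      ∑ v ∈ Φ.elems, ⌊c v - c w⌋ • v, ?_, ?_⟩
    · exact add_nonneg (Int.fract_nonneg _) (div_nonneg (by linarith) (by linarith))
    · rw [Finset.sum_add_distrib, Finset.sum_const, Φ.card_eq, nsmul_eq_mul,
        mul_div_cancel₀ _ (by linarith : (d : ℝ) ≠ 0)]
      ring
    · exact sum_mem fun v hv => zsmul_mem (AddSubgroup.subset_closure hv) _
    · have hc : ∀ v, c v • v = Int.fract (c v - c w) • v + ⌊c v - c w⌋ • v + c w • v := by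
        intro v
        rw [← Int.cast_smul_eq_zsmul ℝ, ← add_smul, ← add_smul, Int.fract_add_floor,
          sub_add_cancel]
      simp only [hc, add_smul, Finset.sum_add_distrib, hzero, add_zero]
  · rw [hV0, ← Φ.span_eq]
    rintro _ ⟨_, ⟨x, hx, rfl⟩, u, hu, rfl⟩
    refine add_mem (Submodule.smul_mem _ _ (convexHull_min Submodule.subset_span (Submodule.convex _) hx)) ?_
    exact (AddSubgroup.closure_le (K := (Submodule.span ℝ _).toAddSubgroup)).2
      Submodule.subset_span hu
end
end

section
/- For every simplex set Φ ⊂ ℝ^d_0 one has ℝ^d_0 ∖ ((n/2) S_Φ° + Δ_Φ) ⊆ W_Φ + Δ_Φ, where S° denotes the interior of S; moreover W_Φ + Δ_Φ = W'_Φ + Δ_Φ. -/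
open scoped Pointwise

noncomputable section

theorem sum_fin_val_real (d : ℕ) : ∑ k : Fin d, (k : ℝ) = d * ((d - 1 : ℝ) / 2) := by
  induction d with
  | zero => simp
  | succ n ih =>
    rw [Fin.sum_univ_castSucc]
    simp only [Fin.val_castSucc, Fin.val_last, ih]
    push_cast
    ring

/-- Up to a common translation and integers, a real `d`-tuple either has nonnegative
coordinates of sum less than `(d - 1) / 2`, or is a permutation of `(ℓ / d)`. -/
theorem small_sum_or_equidistributed (d : ℕ) (hd : 0 < d) (c : Fin d → ℝ) :
    (∃ (b : Fin d → ℝ) (s : ℝ) (m : Fin d → ℤ), (∀ j, c j = b j + s + m j) ∧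
      (∀ j, 0 ≤ b j) ∧ ∑ j, b j < (d - 1 : ℝ) / 2) ∨
    ∃ (σ : Equiv.Perm (Fin d)) (s : ℝ) (m : Fin d → ℤ),
      ∀ ℓ, c (σ ℓ) = (d : ℝ)⁻¹ * (ℓ : ℝ) + s + m (σ ℓ) := by
  have hd' : (0 : ℝ) < d := by exact_mod_cast hd
  set y : Fin d → ℝ := fun j => Int.fract (c j) with hy
  set σ := Tuple.sort y with hσ
  have hmono : Monotone (y ∘ σ) := Tuple.monotone_sort y
  set z : Fin d → ℝ := y ∘ σ with hz
  have hz0 : ∀ j, 0 ≤ z j := fun j => Int.fract_nonneg _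
  have hz1 : ∀ j, z j < 1 := fun j => Int.fract_lt_one _
  have hF : ∀ k : Fin d, ∑ j, (z j - z k + if j < k then 1 else 0) = ∑ j, z j - d * z k + k := by
    intro k
    have : (Finset.univ.filter fun j : Fin d => j < k) = Finset.Iio k := by ext; simp
    simp [Finset.sum_add_distrib, Finset.sum_sub_distrib, this]
  by_cases hk : ∃ k : Fin d, ∑ j, z j - d * z k + k < (d - 1 : ℝ) / 2
  · left
    obtain ⟨k, hk⟩ := hk
    refine ⟨fun j => y j - z k + if σ.symm j < k then 1 else 0, z k,
      fun j => ⌊c j⌋ - if σ.symm j < k then 1 else 0, fun j => ?_, fun j => ?_, ?_⟩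
    · have := Int.fract_add_floor (c j)
      simp only [hy]
      split_ifs <;> push_cast <;> linarith
    · obtain ⟨i, rfl⟩ := σ.surjective j
      have h1 : y (σ i) = z i := rfl
      simp only [Equiv.symm_apply_apply, h1]
      split_ifs with hik
      · linarith [hz0 i, hz1 k]
      · linarith [hmono (not_lt.mp hik)]
    · rw [← hF k] at hk
      rw [← Equiv.sum_comp σ]
      simpa [hz] using hk
  · right
    push Not at hk
    have hsum : ∑ k : Fin d, (∑ j, z j - d * z k + k - (d - 1 : ℝ) / 2) = 0 := by
      simp only [Finset.sum_add_distrib, Finset.sum_sub_distrib, Finset.sum_const,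
        Finset.card_univ, Fintype.card_fin, nsmul_eq_mul, ← Finset.mul_sum, sum_fin_val_real]
      ring
    have heq := (Finset.sum_eq_zero_iff_of_nonneg
      (fun k _ => sub_nonneg.mpr (hk k))).mp hsum
    refine ⟨σ, (d : ℝ)⁻¹ * (∑ j, z j - (d - 1 : ℝ) / 2), fun j => ⌊c j⌋, fun ℓ => ?_⟩
    have h1 := heq ℓ (Finset.mem_univ _)
    have h2 : z ℓ = (d : ℝ)⁻¹ * (ℓ + (∑ j, z j - (d - 1 : ℝ) / 2)) := by
      rw [eq_inv_mul_iff_mul_eq₀ hd'.ne']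
      linarith
    have h3 := Int.fract_add_floor (c (σ ℓ))
    have h4 : z ℓ = Int.fract (c (σ ℓ)) := rfl
    linarith

/-- Strictly positive barycentric combinations of the vertices lie in the relative interior. -/
theorem sum_smul_mem_intrinsicInterior {ι : Type*} [Fintype ι] {E : Type*} [NormedAddCommGroup E]
    [NormedSpace ℝ E] (φ : ι → E) (hφ : ∑ j, φ j = 0) (a : ι → ℝ)
    (ha : ∀ j, 0 < a j) (ha1 : ∑ j, a j = 1) :
    ∑ j, a j • φ j ∈ intrinsicInterior ℝ (convexHull ℝ (Set.range φ)) := by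
  classical
  let L : (ι → ℝ) →ₗ[ℝ] E := Fintype.linearCombination ℝ φ
  have hL : ∀ v, L v = ∑ j, v j • φ j := fun v => by
    simp [L, Fintype.linearCombination_apply]
  let U : Set (ι → ℝ) := {v | ∀ j, 0 < v j + (1 - ∑ i, v i) / Fintype.card ι}
  have hU : IsOpen U := by
    simp only [U, Set.ofPred_forall]
    exact isOpen_iInter_of_finite fun j => isOpen_lt (by fun_prop) (by fun_prop)
  have hopen : IsOpen (L.rangeRestrict '' U) :=
    L.rangeRestrict.isOpenMap_of_finiteDimensional L.surjective_rangeRestrict U hU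
  obtain ⟨O, hO, hOU⟩ := isOpen_induced_iff.mp hopen
  have hne : Nonempty ι := by
    by_contra h
    rw [not_nonempty_iff] at h
    simp at ha1
  have hcard : (Fintype.card ι : ℝ) ≠ 0 := by exact_mod_cast Fintype.card_ne_zero
  have hsub : ∀ v ∈ U, L v ∈ convexHull ℝ (Set.range φ) := by
    intro v hv
    have h1 : L v = ∑ j, (v j + (1 - ∑ i, v i) / Fintype.card ι) • φ j := by
      simp only [add_smul, Finset.sum_add_distrib, ← Finset.smul_sum, hφ, smul_zero, add_zero, hL]
    rw [h1]
    refine (convex_convexHull ℝ _).sum_mem (fun j _ => (hv j).le) ?_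
      fun j _ => subset_convexHull ℝ _ ⟨j, rfl⟩
    simp only [Finset.sum_add_distrib, Finset.sum_const, Finset.card_univ, nsmul_eq_mul]
    field_simp
    ring
  have hspan : (affineSpan ℝ (convexHull ℝ (Set.range φ)) : Set E) ⊆ LinearMap.range L := by
    rw [affineSpan_convexHull]
    refine (affineSpan_subset_span (k := ℝ)).trans ?_
    rw [SetLike.coe_subset_coe, Submodule.span_le]
    rintro _ ⟨j, rfl⟩
    exact ⟨Pi.single j 1, by simp [L]⟩
  have haU : a ∈ U := fun j => by simpa [ha1] using ha j
  rw [mem_intrinsicInterior, ← hL]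
  refine ⟨⟨L a, subset_affineSpan ℝ _ (hsub a haU)⟩, ?_, rfl⟩
  rw [mem_interior]
  refine ⟨Subtype.val ⁻¹' O, ?_, hO.preimage continuous_subtype_val, ?_⟩
  · rintro ⟨p, hp⟩ hpO
    have : (⟨p, hspan hp⟩ : LinearMap.range L) ∈ L.rangeRestrict '' U := by
      rw [← hOU]
      exact hpO
    obtain ⟨v, hv, hvp⟩ := this
    have hvp' : L v = p := congrArg Subtype.val hvp
    exact hvp' ▸ hsub v hv
  · have : L.rangeRestrict a ∈ Subtype.val ⁻¹' O := by
      rw [hOU]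
      exact ⟨a, haU, rfl⟩
    exact this

theorem exists_intMatrix_of_closure_le {m n : ℕ} (u v : Fin m → (Fin n → ℝ))
    (huv : AddSubgroup.closure (Set.range v) ≤ AddSubgroup.closure (Set.range u)) :
    ∃ B : Matrix (Fin m) (Fin m) ℤ,
      (Matrix.of v : Matrix (Fin m) (Fin n) ℝ) = B.map (Int.cast : ℤ → ℝ) * Matrix.of u := by
  have h1 : ∀ i, ∃ c : Fin m → ℤ, ∑ j, c j • u j = v i := fun i => by
    have := huv (AddSubgroup.subset_closure ⟨i, rfl⟩)
    rw [← Submodule.span_int_eq_addSubgroupClosure, Submodule.mem_toAddSubgroup,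
      Submodule.mem_span_range_iff_exists_fun] at this
    exact this
  choose B hB using h1
  refine ⟨Matrix.of B, ?_⟩
  ext i k
  simp [Matrix.mul_apply, ← hB i]

/-- The Gram determinant depends only on the lattice. -/
theorem det_mul_transpose_eq_of_closure_eq {m n : ℕ} (u v : Fin m → (Fin n → ℝ))
    (hu : LinearIndependent ℝ u)
    (huv : AddSubgroup.closure (Set.range v) = AddSubgroup.closure (Set.range u)) :
    ((Matrix.of v : Matrix (Fin m) (Fin n) ℝ) * (Matrix.of v).transpose).det =
      ((Matrix.of u : Matrix (Fin m) (Fin n) ℝ) * (Matrix.of u).transpose).det := by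
  obtain ⟨B, hB⟩ := exists_intMatrix_of_closure_le u v huv.le
  obtain ⟨A, hA⟩ := exists_intMatrix_of_closure_le v u huv.ge
  have hinj : Function.Injective fun w => Matrix.vecMul w (Matrix.of u) :=
    Matrix.vecMul_injective_iff.mpr hu
  set A' : Matrix (Fin m) (Fin m) ℝ := A.map (Int.cast : ℤ → ℝ) with hA'
  set B' : Matrix (Fin m) (Fin m) ℝ := B.map (Int.cast : ℤ → ℝ) with hB'
  have hAB : A' * B' = 1 := by
    refine funext fun i => hinj ?_
    have h1 : A' * B' * Matrix.of u = (1 : Matrix (Fin m) (Fin m) ℝ) * Matrix.of u := by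
      rw [Matrix.mul_assoc, ← hB, ← hA, Matrix.one_mul]
    have h2 := congrFun h1 i
    rwa [Matrix.mul_apply_eq_vecMul, Matrix.mul_apply_eq_vecMul] at h2
  have hdet : A.det * B.det = 1 := by
    have h1 : (A.det : ℝ) * (B.det : ℝ) = 1 := by
      have h2 : ∀ C : Matrix (Fin m) (Fin m) ℤ, (C.det : ℝ) = (C.map (Int.cast : ℤ → ℝ)).det :=
        fun C => (Int.castRingHom ℝ).map_det C
      rw [h2, h2, ← Matrix.det_mul, ← hA', ← hB', hAB, Matrix.det_one]
    exact_mod_cast h1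
  have hBdet : B'.det * B'.det = 1 := by
    have h2 : B'.det = (B.det : ℝ) := ((Int.castRingHom ℝ).map_det B).symm
    rw [h2]
    exact_mod_cast Int.isUnit_mul_self (IsUnit.of_mul_eq_one_right _ hdet)
  rw [hB, Matrix.transpose_mul, Matrix.mul_assoc, ← Matrix.mul_assoc (Matrix.of u),
    Matrix.det_mul, Matrix.det_mul, Matrix.det_transpose]
  linear_combination ((Matrix.of u : Matrix (Fin m) (Fin n) ℝ) *
    (Matrix.of u).transpose).det * hBdet

theorem gram_eq_sqrt_det (d : ℕ) (v : Fin (d - 1) → (Fin d → ℝ)) :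
    gram d v = Real.sqrt |((Matrix.of v : Matrix (Fin (d - 1)) (Fin d) ℝ) *
      (Matrix.of v).transpose).det| := by
  unfold gram
  congr 3

theorem covolSet_pos_of_linearIndependent (d : ℕ) (S : Set (Fin d → ℝ))
    (u : Fin (d - 1) → (Fin d → ℝ)) (hu : LinearIndependent ℝ u)
    (hS : AddSubgroup.closure (Set.range u) = AddSubgroup.closure S) :
    0 < covolSet d S := by
  have hset : {r | ∃ v : Fin (d - 1) → (Fin d → ℝ),
      AddSubgroup.closure (Set.range v) = AddSubgroup.closure S ∧ r = gram d v} = {gram d u} := by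
    ext r
    constructor
    · rintro ⟨v, hv, rfl⟩
      rw [Set.mem_singleton_iff, gram_eq_sqrt_det, gram_eq_sqrt_det,
        det_mul_transpose_eq_of_closure_eq u v hu (hv.trans hS.symm)]
    · rintro rfl
      exact ⟨u, hS, rfl⟩
  rw [covolSet, hset, csInf_singleton, gram_eq_sqrt_det, Real.sqrt_pos, abs_pos]
  have := (Matrix.PosDef.mul_conjTranspose_self (Matrix.of u : Matrix (Fin (d - 1)) (Fin d) ℝ)
    (Matrix.vecMul_injective_iff.mpr hu)).det_pos
  rw [Matrix.conjTranspose_eq_transpose_of_trivial] at this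
  exact this.ne'

theorem finrank_V0sub_s11 (n : ℕ) : Module.finrank ℝ (V0sub (n + 1)) = n := by
  have hne : (∑ i : Fin (n + 1), LinearMap.proj (R := ℝ) (φ := fun _ => ℝ) i) ≠ 0 := by
    intro h0
    have h1 := LinearMap.congr_fun h0 (Pi.single 0 1)
    simp [LinearMap.sum_apply] at h1
  have := Module.Dual.finrank_ker_add_one_of_ne_zero (V₁ := Fin (n + 1) → ℝ) hne
  simp only [Module.finrank_fintype_fun_eq_card, Fintype.card_fin] at this
  unfold V0sub
  omega

theorem sum_bstar (d : ℕ) : ∑ j, bstar d j = 0 := by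
  ext i
  have h1 : ∀ j, bstar d j i = 1 - if i = j then (d : ℝ) else 0 := fun j => by
    unfold bstar
    split_ifs <;> ring
  simp [Finset.sum_apply, h1]

theorem wStar_eq (d : ℕ) (τ : Equiv.Perm (Fin d)) :
    wStar d τ = ∑ ℓ : Fin d, ((d : ℝ)⁻¹ * (ℓ : ℝ)) • bstar d (τ ℓ) := by
  ext i
  have h1 : ∀ ℓ, bstar d (τ ℓ) i = bstar d ℓ (τ.symm i) := fun ℓ => by
    simp only [bstar, Equiv.symm_apply_eq]
  simp only [wStar, Finset.sum_apply, Pi.smul_apply, smul_eq_mul, h1, Finset.mul_sum, mul_assoc]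

/-- The vertices `h_Φ b_j`, rescaled, enumerate `Φ`; the points `w_τ` are explicit in them. -/
theorem IsDistortion.exists_enumeration {d : ℕ} (hd : 2 ≤ d) {Φ : SimplexSet d}
    {h : (Fin d → ℝ) →ₗ[ℝ] (Fin d → ℝ)} (hh : IsDistortion Φ h) :
    ∃ φ : Fin d → (Fin d → ℝ), Set.range φ = (Φ.elems : Set (Fin d → ℝ)) ∧ ∑ j, φ j = 0 ∧
      ∀ τ, wPhi Φ h τ = ∑ ℓ : Fin d, ((d : ℝ)⁻¹ * (ℓ : ℝ)) • φ (τ ℓ) := by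
  have hpos := covolSS_pos hd Φ
  set c : ℝ := (covolSS Φ) ^ ((1 : ℝ) / (d - 1 : ℝ)) with hc
  have hc0 : c ≠ 0 := (Real.rpow_pos_of_pos hpos _).ne'
  have hcinv : (covolSS Φ) ^ (-(1 : ℝ) / (d - 1 : ℝ)) = c⁻¹ := by
    rw [hc, ← Real.rpow_neg hpos.le, neg_div]
  refine ⟨fun j => c • h (bstar d j), ?_, ?_, fun τ => ?_⟩
  · unfold IsDistortion at hh
    rw [hcinv] at hh
    have h1 : Set.range (fun j => c • h (bstar d j)) = c • (h '' Set.range (bstar d)) := by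
      rw [← Set.range_comp, ← Set.image_smul, ← Set.range_comp]
      rfl
    rw [h1, hh, Set.image_smul, smul_inv_smul₀ hc0]
  · rw [← Finset.smul_sum, ← map_sum, sum_bstar, map_zero, smul_zero]
  · unfold wPhi
    rw [wStar_eq, map_sum, Finset.smul_sum]
    refine Finset.sum_congr rfl fun ℓ _ => ?_
    rw [map_smul, smul_comm]

theorem sum_finRotate_sub_sum {n : ℕ} {E : Type*} [AddCommGroup E] [Module ℝ E]
    (φ : Fin (n + 1) → E) (hφ : ∑ j, φ j = 0) :
    ∑ ℓ : Fin (n + 1), (((n + 1 : ℕ) : ℝ)⁻¹ * (ℓ : ℝ)) • φ (finRotate (n + 1) ℓ) =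
      ∑ ℓ : Fin (n + 1), (((n + 1 : ℕ) : ℝ)⁻¹ * (ℓ : ℝ)) • φ ℓ + φ 0 := by
  have hn : ((n : ℝ) + 1) ≠ 0 := by positivity
  have h1 : ∀ i : Fin n, finRotate (n + 1) i.castSucc = i.succ := fun i => by
    ext
    rw [coe_finRotate_of_ne_last (Fin.castSucc_lt_last i).ne]
    simp
  rw [Fin.sum_univ_castSucc, Fin.sum_univ_succ
    (f := fun ℓ : Fin (n + 1) => (((n + 1 : ℕ) : ℝ)⁻¹ * (ℓ : ℝ)) • φ ℓ)]
  rw [Fin.sum_univ_succ, add_eq_zero_iff_eq_neg] at hφ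
  simp only [h1, finRotate_last, Fin.val_castSucc, Fin.val_last, Fin.val_succ, Fin.val_zero,
    Nat.cast_add, Nat.cast_one, mul_add, mul_one, add_smul, Finset.sum_add_distrib,
    ← Finset.smul_sum, Nat.cast_zero, mul_zero, zero_smul, zero_add]
  have h2 : ∑ i : Fin n, φ i.succ = -φ 0 := by rw [hφ, neg_neg]
  rw [h2, add_assoc]
  congr 1
  have h3 : ((n : ℝ) + 1)⁻¹ * n = 1 - ((n : ℝ) + 1)⁻¹ := by
    field_simp
    ring
  rw [h3]
  module

theorem wPhi_mul_sub_mem {d : ℕ} (hd : 2 ≤ d) {Φ : SimplexSet d}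
    {h : (Fin d → ℝ) →ₗ[ℝ] (Fin d → ℝ)} (hh : IsDistortion Φ h) (ρ : Equiv.Perm (Fin d))
    (hρ : ρ ∈ Subgroup.zpowers (finRotate d)) (τ : Equiv.Perm (Fin d)) :
    wPhi Φ h (τ * ρ) - wPhi Φ h τ ∈ latticeOfSS Φ := by
  obtain ⟨φ, hr, hs, hw⟩ := hh.exists_enumeration hd
  let H : Subgroup (Equiv.Perm (Fin d)) :=
    { carrier := {ρ | ∀ τ, wPhi Φ h (τ * ρ) - wPhi Φ h τ ∈ latticeOfSS Φ}
      mul_mem' := fun {a b} ha hb τ => by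
        have := add_mem (hb (τ * a)) (ha τ)
        rwa [sub_add_sub_cancel, mul_assoc] at this
      one_mem' := fun τ => by simp
      inv_mem' := fun {a} ha τ => by
        have := neg_mem (ha (τ * a⁻¹))
        rwa [inv_mul_cancel_right, neg_sub] at this }
  refine (Subgroup.zpowers_le (H := H)).mpr (fun τ => ?_) hρ τ
  obtain ⟨n, rfl⟩ : ∃ n, d = n + 1 := ⟨d - 1, by omega⟩
  have := sum_finRotate_sub_sum (fun j => φ (τ j)) ((Equiv.sum_comp τ φ).trans hs)
  rw [hw, hw]
  simp only [Equiv.Perm.mul_apply]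
  rw [this, add_sub_cancel_left]
  exact AddSubgroup.subset_closure (hr ▸ ⟨_, rfl⟩)

theorem stmt11 (d : ℕ) (hd : 2 ≤ d) (Φ : SimplexSet d)
    (h : (Fin d → ℝ) →ₗ[ℝ] (Fin d → ℝ)) (hh : IsDistortion Φ h)
    (S' : Set (Equiv.Perm (Fin d))) (hS' : IsRepSet d S') :
    (V0 d \ (((d - 1 : ℝ) / 2) • intrinsicInterior ℝ (convexHull ℝ (Φ.elems : Set (Fin d → ℝ))) +
        (latticeOfSS Φ : Set (Fin d → ℝ))) ⊆
      Set.range (wPhi Φ h) + (latticeOfSS Φ : Set (Fin d → ℝ))) ∧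
    Set.range (wPhi Φ h) + (latticeOfSS Φ : Set (Fin d → ℝ)) =
      wPhi Φ h '' S' + (latticeOfSS Φ : Set (Fin d → ℝ)) := by
  constructor
  · rintro x ⟨hx, hxn⟩
    obtain ⟨φ, hr, hs, hw⟩ := hh.exists_enumeration hd
    have hd' : (0 : ℝ) < d := by exact_mod_cast (by omega : 0 < d)
    have hn : (0 : ℝ) < (d - 1 : ℝ) / 2 := by
      have : (2 : ℝ) ≤ d := by exact_mod_cast hd
      linarith
    have hlat : ∀ m : Fin d → ℤ, ∑ j, (m j : ℝ) • φ j ∈ latticeOfSS Φ := fun m =>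
      sum_mem fun j _ => by
        rw [Int.cast_smul_eq_zsmul]
        exact zsmul_mem (AddSubgroup.subset_closure (hr ▸ ⟨j, rfl⟩)) _
    have hxs : x ∈ Submodule.span ℝ (Set.range φ) := by
      rw [hr, Φ.span_eq, V0sub, LinearMap.mem_ker, LinearMap.sum_apply]
      exact hx
    obtain ⟨c, rfl⟩ := (Submodule.mem_span_range_iff_exists_fun ℝ).mp hxs
    rcases small_sum_or_equidistributed d (by omega) c with
      ⟨b, s, m, hc, hb, hbs⟩ | ⟨σ, s, m, hc⟩
    · refine absurd ?_ hxn
      set q : ℝ := (d - 1 : ℝ) / 2 with hq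
      set δ : ℝ := (q - ∑ j, b j) / d with hδ
      have hδ0 : 0 < δ := div_pos (sub_pos.mpr hbs) hd'
      refine ⟨∑ j, b j • φ j, ⟨∑ j, (q⁻¹ * (b j + δ)) • φ j, ?_, ?_⟩,
        ∑ j, (m j : ℝ) • φ j, hlat m, ?_⟩
      · rw [← hr]
        refine sum_smul_mem_intrinsicInterior φ hs _
          (fun j => mul_pos (inv_pos.mpr hn) (add_pos_of_nonneg_of_pos (hb j) hδ0)) ?_
        rw [← Finset.mul_sum, Finset.sum_add_distrib, Finset.sum_const, Finset.card_univ,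
          Fintype.card_fin, nsmul_eq_mul, hδ, mul_div_cancel₀ _ hd'.ne', add_sub_cancel,
          inv_mul_cancel₀ hn.ne']
      · simp only [mul_smul, ← Finset.smul_sum, smul_inv_smul₀ hn.ne', add_smul,
          Finset.sum_add_distrib, hs, smul_zero, add_zero]
      · simp only [hc, add_smul, Finset.sum_add_distrib, ← Finset.smul_sum, hs, smul_zero,
          add_zero]
    · refine ⟨wPhi Φ h σ, ⟨σ, rfl⟩, ∑ j, (m j : ℝ) • φ j, hlat m, ?_⟩
      simp only [hw]
      rw [← Equiv.sum_comp σ (fun j => (m j : ℝ) • φ j), ← Equiv.sum_comp σ (fun j => c j • φ j)]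
      simp only [hc, add_smul, Finset.sum_add_distrib, ← Finset.smul_sum,
        Equiv.sum_comp σ φ, hs, smul_zero, add_zero]
  · apply subset_antisymm
    · rintro _ ⟨_, ⟨τ, rfl⟩, v, hv, rfl⟩
      obtain ⟨σ, ⟨hσ, hσ'⟩, -⟩ := hS' τ
      have h1 := wPhi_mul_sub_mem hd hh _ hσ' τ
      rw [mul_inv_cancel_left] at h1
      refine ⟨wPhi Φ h σ, ⟨σ, hσ, rfl⟩, v - (wPhi Φ h σ - wPhi Φ h τ), sub_mem hv h1, ?_⟩
      simp only
      abel
    · exact Set.add_subset_add_right (Set.image_subset_range _ _)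
end
end
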